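/- arXiv:2311.07208 — 3 statements merged into one kernel-verified Lean document; each statement's English description precedes it below -/
import Mathlib

section
/- Let f: [0,1] → [0,1] be a continuous map with zero topological entropy. Then the set of invariant measures supported on periodic orbits of f is dense in the set of ergodic f-invariant measures with the weak* topology. -/
open MeasureTheory Filter Topology
open scoped ENNReal NNReal

section Defs

variable {X : Type*} [MetricSpace X] [MeasurableSpace X] [BorelSpace X]

/-- Kantorovich–Rubinshtein (dual-Lipschitz) distance between two measures:
the supremum of `|∫ f dμ - ∫ f dν|` over bounded `f` with Lipschitz constant at most `1`. -/
noncomputable def krDist (μ ν : Measure X) : ℝ :=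
  sSup { r : ℝ | ∃ f : X → ℝ, LipschitzWith 1 f ∧ (∃ C, ∀ x, |f x| ≤ C) ∧
    r = |∫ x, f x ∂μ - ∫ x, f x ∂ν| }

/-- Empirical measure of the first `n` terms of a sequence (as a plain measure). -/
noncomputable def empMeas (x : ℕ → X) (n : ℕ) : Measure X :=
  (n : ℝ≥0∞)⁻¹ • ∑ i ∈ Finset.range n, Measure.dirac (x i)

/-- Average of the Dirac measures at the first `max n 1` points of a sequence, as a
probability measure.  For `n ≥ 1` this is the `n`-th empirical measure. -/
noncomputable def avgDirac (x : ℕ → X) (n : ℕ) : ProbabilityMeasure X :=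
  ⟨((max n 1 : ℕ) : ℝ≥0∞)⁻¹ • ∑ i ∈ Finset.range (max n 1), Measure.dirac (x i), by
    constructor
    have h : (∑ i ∈ Finset.range (max n 1), Measure.dirac (x i)) Set.univ
        = ((max n 1 : ℕ) : ℝ≥0∞) := by
      simp [Measure.finset_sum_apply]
    rw [Measure.smul_apply, h, smul_eq_mul]
    exact ENNReal.inv_mul_cancel (by simp) (by simp)⟩

/-- The set of weak* limit points of the empirical measures of a sequence. -/
def limitMeasures (x : ℕ → X) : Set (ProbabilityMeasure X) :=
  { μ | ∃ φ : ℕ → ℕ, StrictMono φ ∧ Tendsto (fun k => avgDirac x (φ k)) atTop (𝓝 μ) }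

/-- `x` is a generic point for `μ`: the empirical measures along the orbit of `x`
converge to `μ` in the weak* topology. -/
def genericFor (T : X → X) (x : X) (μ : ProbabilityMeasure X) : Prop :=
  Tendsto (fun n => avgDirac (fun i => T^[i] x) n) atTop (𝓝 μ)

/-- The invariant measure supported on the periodic orbit of `x` of period `p`. -/
noncomputable def periodicOrbitMeasure (T : X → X) (x : X) (p : ℕ) : ProbabilityMeasure X :=
  avgDirac (fun i => T^[i] x) p

/-- The set of invariant measures supported on periodic orbits of points of `K`. -/
def perMeasures (T : X → X) (K : Set X) : Set (ProbabilityMeasure X) :=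
  { μ | ∃ x ∈ K, ∃ p, 0 < p ∧ T^[p] x = x ∧ μ = periodicOrbitMeasure T x p }

/-- The mean orbital pseudo-metric `Ē`. -/
noncomputable def meanOrbitalDist (T : X → X) (x y : X) : ℝ :=
  limsup (fun n => ⨅ σ : Equiv.Perm (Fin n),
    (∑ i : Fin n, dist (T^[(i : ℕ)] x) (T^[((σ i : Fin n) : ℕ)] y)) / n) atTop

/-- `x` is an asymptotic average pseudo-orbit for `T`. -/
def IsAAPO (T : X → X) (x : ℕ → X) : Prop :=
  Tendsto (fun n => (∑ i ∈ Finset.range n, dist (T (x i)) (x (i + 1))) / n) atTop (𝓝 0)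

/-- The point `x` is `K`-closable. -/
def ClosableAt (T : X → X) (K : Set X) (x : X) : Prop :=
  ∀ ε > (0 : ℝ), ∀ N : ℕ, ∃ p q : ℕ, 0 < p ∧ N ≤ p ∧ p ≤ q ∧ (q : ℝ) ≤ (1 + ε) * p ∧
    ∃ y ∈ K, T^[q] y = y ∧ ∀ i < p, dist (T^[i] y) (T^[i] x) < ε

/-- The set `K ⊆ Per(T)` is linkable. -/
def Linkable (T : X → X) (K : Set X) : Prop :=
  ∀ y₁ ∈ K, ∀ y₂ ∈ K, ∀ ε > (0 : ℝ), ∀ lam ∈ Set.Icc (0 : ℝ) 1,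
    ∃ p₁ p₂ q₁ q₂ : ℕ, 0 < p₁ ∧ 0 < p₂ ∧ T^[p₁] y₁ = y₁ ∧ T^[p₂] y₂ = y₂ ∧
      ∃ z ∈ K, T^[q₂] z = z ∧
        lam - ε ≤ (p₁ : ℝ) / (p₁ + p₂) ∧ (p₁ : ℝ) / (p₁ + p₂) ≤ lam + ε ∧
        p₁ ≤ q₁ ∧ (q₁ : ℝ) ≤ (1 + ε) * p₁ ∧ (∀ i < p₁, dist (T^[i] z) (T^[i] y₁) < ε) ∧
        p₂ ≤ q₂ - q₁ ∧ ((q₂ - q₁ : ℕ) : ℝ) ≤ (1 + ε) * p₂ ∧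
        (∀ i < p₂, dist (T^[i + q₁] z) (T^[i] y₂) < ε)

/-- `(X,T)` has the asymptotic orbital average shadowing property. -/
def AOASP (T : X → X) : Prop :=
  ∀ x : ℕ → X, IsAAPO T x → ∃ z : X,
    Tendsto (fun n => ⨅ σ : Equiv.Perm (Fin n),
      (∑ i : Fin n, dist (x (i : ℕ)) (T^[((σ i : Fin n) : ℕ)] z)) / n) atTop (𝓝 0)

end Defs

/-- A horseshoe for `T^[N]`: two disjoint nonempty compact sets, each of which is mapped by `T^[N]`
over their union. -/
def HasHorseshoe {X : Type*} [TopologicalSpace X] (T : X → X) (N : ℕ) : Prop :=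
  ∃ J K : Set X, IsCompact J ∧ IsCompact K ∧ Disjoint J K ∧ J.Nonempty ∧
    J ∪ K ⊆ T^[N] '' J ∧ J ∪ K ⊆ T^[N] '' K

lemma exists_itinerary {X : Type*} {G : X → X} {J K : Set X} (hne : J.Nonempty)
    (hJ : J ∪ K ⊆ G '' J) (hK : J ∪ K ⊆ G '' K) (n : ℕ) (w : ℕ → Bool) :
    ∃ x ∈ J ∪ K, ∀ i < n, G^[i] x ∈ cond (w i) J K := by
  induction n generalizing w with
  | zero => exact ⟨hne.some, Or.inl hne.some_mem, fun i hi => absurd hi (Nat.not_lt_zero i)⟩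
  | succ n ih =>
    obtain ⟨y, hy, hyw⟩ := ih fun i => w (i + 1)
    obtain ⟨x, hx, rfl⟩ : ∃ x ∈ cond (w 0) J K, G x = y := by
      cases w 0
      · exact hK hy
      · exact hJ hy
    refine ⟨x, ?_, fun i hi => ?_⟩
    · revert hx
      cases w 0
      · exact Or.inr
      · exact Or.inl
    · cases i with
      | zero => exact hx
      | succ i => exact hyw i (by omega)

lemma HasHorseshoe.coverEntropy_pos {X : Type*} [MetricSpace X] {T : X → X} {N : ℕ}
    (h : HasHorseshoe T N) : 0 < Dynamics.coverEntropy T Set.univ := by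
  classical
  obtain ⟨J, K, hJc, hKc, hd, hne, hJ, hK⟩ := h
  have hN : N ≠ 0 := by
    rintro rfl
    obtain ⟨x, hx⟩ := hne
    obtain ⟨y, hy, hyx⟩ := hK (Or.inl hx)
    simp only [Function.iterate_zero, id_eq] at hyx
    exact Set.disjoint_left.1 hd hx (hyx ▸ hy)
  obtain ⟨δ, hδ, hsep⟩ : ∃ δ > 0, ∀ x ∈ J, ∀ y ∈ K, δ < dist x y := by
    obtain ⟨r, hr, hrsep⟩ := Metric.exists_pos_forall_lt_edist hJc hKc.isClosed hd
    refine ⟨r, hr, fun x hx y hy => ?_⟩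
    have := hrsep x hx y hy
    rw [edist_nndist, ENNReal.coe_lt_coe] at this
    exact_mod_cast this
  choose pt _ hpt using fun (n : ℕ) (w : ℕ → Bool) => exists_itinerary hne hJ hK n w
  let U : SetRel X X := {p | dist p.1 p.2 < δ / 2}
  have hU : U ∈ uniformity X := Metric.dist_mem_uniformity (half_pos hδ)
  let ext (n : ℕ) (w : Fin n → Bool) : ℕ → Bool := fun i => if hi : i < n then w ⟨i, hi⟩ else true
  have key (n : ℕ) (w w' : Fin n → Bool) (hw : w ≠ w') :
      Disjoint (UniformSpace.ball (pt n (ext n w)) (Dynamics.dynEntourage T U (N * n)))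
        (UniformSpace.ball (pt n (ext n w')) (Dynamics.dynEntourage T U (N * n))) := by
    rw [Set.disjoint_left]
    intro z hz hz'
    obtain ⟨⟨i, hi⟩, hwi⟩ := Function.ne_iff.1 hw
    have hlt : N * i < N * n := Nat.mul_lt_mul_of_pos_left hi (Nat.pos_of_ne_zero hN)
    have h1 : dist (T^[N * i] (pt n (ext n w))) (T^[N * i] z) < δ / 2 :=
      Dynamics.mem_dynEntourage.1 hz _ hlt
    have h2 : dist (T^[N * i] (pt n (ext n w'))) (T^[N * i] z) < δ / 2 :=
      Dynamics.mem_dynEntourage.1 hz' _ hlt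
    have h3 := dist_triangle_right (T^[N * i] (pt n (ext n w))) (T^[N * i] (pt n (ext n w')))
      (T^[N * i] z)
    have e1 := hpt n (ext n w) i hi
    have e2 := hpt n (ext n w') i hi
    simp only [ext, hi, dif_pos, ← Function.iterate_mul] at e1 e2
    cases hb : w ⟨i, hi⟩ <;> cases hb' : w' ⟨i, hi⟩ <;> simp only [hb, hb', cond_true, cond_false,
      ne_eq, not_true_eq_false] at e1 e2 hwi
    · have := hsep _ e2 _ e1
      rw [dist_comm] at this
      simp only [ext] at h3
      linarith
    · have := hsep _ e1 _ e2
      linarith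
  have hcard (n : ℕ) : ((2 ^ n : ℕ) : ℕ∞) ≤ Dynamics.netMaxcard T Set.univ U (N * n) := by
    have hinj : Function.Injective fun w : Fin n → Bool => pt n (ext n w) := by
      intro w w' hww
      by_contra hne'
      have hd' := key n w w' hne'
      simp only at hww
      rw [hww, disjoint_self] at hd'
      have hmem : pt n (ext n w') ∈
          UniformSpace.ball (pt n (ext n w')) (Dynamics.dynEntourage T U (N * n)) :=
        Dynamics.mem_dynEntourage.2 fun k _ => show dist _ _ < δ / 2 by simpa using hδ
      rw [hd'] at hmem
      exact hmem
    have hnet : Dynamics.IsDynNetIn T Set.univ U (N * n)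
        ((Finset.univ.image fun w : Fin n → Bool => pt n (ext n w) : Finset X) : Set X) := by
      refine ⟨Set.subset_univ _, ?_⟩
      intro x hx y hy hxy
      simp only [Finset.coe_image, Finset.coe_univ, Set.image_univ, Set.mem_range] at hx hy
      obtain ⟨w, rfl⟩ := hx
      obtain ⟨w', rfl⟩ := hy
      exact key n w w' fun hww => hxy (by rw [hww])
    have := hnet.card_le_netMaxcard
    rwa [Finset.card_image_of_injective _ hinj, Finset.card_univ, Fintype.card_fun,
      Fintype.card_bool, Fintype.card_fin] at this
  have hmono : Monotone fun n : ℕ => (Dynamics.netMaxcard T Set.univ U n : ℝ≥0∞) :=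
    fun _ _ hmn => ENat.toENNReal_mono (Dynamics.netMaxcard_monotone_time T Set.univ U hmn)
  have hgrowth : ENNReal.log 2 ≤ N * Dynamics.netEntropyEntourage T Set.univ U := by
    rw [Dynamics.netEntropyEntourage, ← hmono.expGrowthSup_comp_mul hN, ← ExpGrowth.expGrowthSup_pow]
    refine ExpGrowth.expGrowthSup_monotone fun n => ?_
    have h2 := ENat.toENNReal_mono (hcard n)
    simpa using h2
  have hlog : (0 : EReal) < ENNReal.log 2 := by
    rw [← ENNReal.log_one]
    exact ENNReal.log_strictMono (by norm_num)
  refine lt_of_lt_of_le ?_ (Dynamics.netEntropyEntourage_le_coverEntropy T Set.univ hU)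
  by_contra! hle
  have hmul : (N : EReal) * Dynamics.netEntropyEntourage T Set.univ U ≤ N * 0 :=
    mul_le_mul_of_nonneg_left hle (by positivity)
  rw [mul_zero] at hmul
  exact absurd (hlog.trans_le hgrowth) (not_lt.2 hmul)

/-- `y` is an infinite orbit of `F` all of whose points are recurrent. -/
structure RecurrentOrbit (F : ℝ → ℝ) (y : ℕ → ℝ) : Prop where
  step : ∀ k, y (k + 1) = F (y k)
  injective : Function.Injective y
  recurrent : ∀ j, ∀ V ∈ 𝓝 (y j), ∃ᶠ k in atTop, y k ∈ V

namespace RecurrentOrbit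

variable {F : ℝ → ℝ} {y : ℕ → ℝ}

lemma iterate (h : RecurrentOrbit F y) (n k : ℕ) : F^[n] (y k) = y (k + n) := by
  induction n with
  | zero => rfl
  | succ n ih => rw [Function.iterate_succ_apply', ih, ← h.step]; rfl

lemma neg (h : RecurrentOrbit F y) : RecurrentOrbit (fun x => -F (-x)) (fun k => -y k) where
  step k := by simp [h.step]
  injective := neg_injective.comp h.injective
  recurrent j V hV := by
    have := h.recurrent j _ (continuous_neg.continuousAt.preimage_mem_nhds hV)
    exact this

lemma ne_of_fixed (h : RecurrentOrbit F y) {z : ℝ} (hz : F z = z) (k : ℕ) : y k ≠ z := by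
  intro hk
  have h1 : y (k + 1) = y k := by rw [h.step, hk, hz]
  exact absurd (h.injective h1) (by omega)

end RecurrentOrbit

lemma iterate_neg_conj (F : ℝ → ℝ) (n : ℕ) (x : ℝ) :
    (fun x => -F (-x))^[n] x = -(F^[n] (-x)) := by
  induction n with
  | zero => simp
  | succ n ih => simp only [Function.iterate_succ_apply', ih, neg_neg]

lemma HasHorseshoe.of_neg {F : ℝ → ℝ} {N : ℕ} (h : HasHorseshoe (fun x => -F (-x)) N) :
    HasHorseshoe F N := by
  obtain ⟨J, K, hJ, hK, hd, hne, h1, h2⟩ := h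
  have key {A B : Set ℝ} (hAB : A ⊆ (fun x => -F (-x))^[N] '' B) : -A ⊆ F^[N] '' (-B) := by
    intro x hx
    obtain ⟨b, hb, hbx⟩ := hAB hx
    rw [iterate_neg_conj] at hbx
    exact ⟨-b, by simpa using hb, by linarith⟩
  refine ⟨-J, -K, hJ.neg, hK.neg, ?_, hne.neg, ?_, ?_⟩
  · rw [Set.disjoint_left] at hd ⊢
    exact fun x hx hx' => hd hx hx'
  · rw [← Set.union_neg]
    exact key h1
  · rw [← Set.union_neg]
    exact key h2

namespace RecurrentOrbit

variable {F : ℝ → ℝ} {y : ℕ → ℝ}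

/-- Without horseshoes, an orbit containing a point that moves up and lies above a fixed point
stays above that fixed point. -/
lemma fixed_lt (h : RecurrentOrbit F y) (hF : Continuous F) (hno : ∀ N, ¬ HasHorseshoe F N)
    {z : ℝ} (hz : F z = z) {j : ℕ} (hzj : z < y j) (hup : y j < y (j + 1)) (i : ℕ) : z < y i := by
  by_contra! hi
  have hi' : y i < z := lt_of_le_of_ne hi (h.ne_of_fixed hz i)
  obtain ⟨t, hjt, ht⟩ := frequently_atTop.1 (h.recurrent i _ (Iio_mem_nhds hi')) (j + 1)
  obtain ⟨n, rfl⟩ := Nat.exists_eq_add_of_le hjt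
  have hGz (m : ℕ) : F^[m] z = z := Function.iterate_fixed hz m
  have hcover : Set.Icc z (y j) ⊆ F '' Set.Icc z (y j) := by
    refine (Set.Icc_subset_Icc_right hup.le).trans ?_
    have := intermediate_value_Icc hzj.le hF.continuousOn
    rwa [hz, ← h.step] at this
  have hcovern (m : ℕ) : Set.Icc z (y j) ⊆ F^[m] '' Set.Icc z (y j) := by
    induction m with
    | zero => simp
    | succ m ih =>
      rw [Function.iterate_succ', Set.image_comp]
      exact hcover.trans (Set.image_mono ih)
  have hcover' : Set.Icc z (y (j + 1)) ⊆ F^[n + 1] '' Set.Icc z (y j) := by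
    rw [Function.iterate_succ', Set.image_comp]
    refine Set.Subset.trans ?_ (Set.image_mono (hcovern n))
    have := intermediate_value_Icc hzj.le hF.continuousOn
    rwa [hz, ← h.step] at this
  set G := F^[n + 1] with hG
  have hGc : Continuous G := hF.iterate _
  have hGa : G (y j) < z := by
    rw [hG, h.iterate, show j + (n + 1) = j + 1 + n by ring]
    exact ht
  obtain ⟨e, he, hGe⟩ := hcover' (Set.right_mem_Icc.2 (hzj.trans hup).le)
  have hea : e < y j := lt_of_le_of_ne he.2 fun hh => by rw [hh] at hGe; linarith
  have hze : z ≤ e := he.1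
  obtain ⟨k, hk, hGk⟩ := intermediate_value_Icc' hea.le hGc.continuousOn
    (show y j ∈ Set.Icc (G (y j)) (G e) from ⟨by linarith, by linarith⟩)
  have hek : e < k := lt_of_le_of_ne hk.1 fun hh => by rw [← hh] at hGk; linarith
  have hun : Set.Icc z e ∪ Set.Icc k (y j) ⊆ Set.Icc z (y j) :=
    Set.union_subset (Set.Icc_subset_Icc_right hea.le)
      (Set.Icc_subset_Icc_left (hze.trans hek.le))
  refine hno (n + 1) ⟨Set.Icc z e, Set.Icc k (y j), isCompact_Icc, isCompact_Icc, ?_,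
    Set.nonempty_Icc.2 hze, hun.trans ?_, hun.trans ?_⟩
  · rw [Set.disjoint_left]
    exact fun x hx hx' => absurd (hx.2.trans_lt hek) (not_lt.2 hx'.1)
  · have := intermediate_value_Icc hze hGc.continuousOn
    rw [hGe, hG, hGz] at this
    exact (Set.Icc_subset_Icc_right hup.le).trans this
  · have := intermediate_value_Icc' hk.2 hGc.continuousOn
    rw [hGk] at this
    exact (Set.Icc_subset_Icc_left hGa.le).trans this

lemma exists_up (h : RecurrentOrbit F y) : ∃ k, y k < y (k + 1) := by
  by_contra! hk
  have hanti : Antitone y := antitone_nat_of_succ_le hk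
  have h01 : y 1 < y 0 := lt_of_le_of_ne (hk 0) fun hh => absurd (h.injective hh) one_ne_zero
  obtain ⟨t, ht, hy⟩ := frequently_atTop.1 (h.recurrent 0 _ (Ioi_mem_nhds h01)) 1
  exact absurd (hanti ht) (not_le.2 hy)

lemma exists_down (h : RecurrentOrbit F y) : ∃ k, y (k + 1) < y k := by
  obtain ⟨k, hk⟩ := h.neg.exists_up
  exact ⟨k, by simpa using hk⟩

/-- Without horseshoes, a fixed point separates the orbit points moving up from those moving
down. -/
lemma exists_fixed (h : RecurrentOrbit F y) (hF : Continuous F) (hno : ∀ N, ¬ HasHorseshoe F N) :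
    ∃ z, F z = z ∧ (∀ k, y k < z → y k < y (k + 1)) ∧ ∀ k, z < y k → y (k + 1) < y k := by
  have hlt {i j : ℕ} (hi : y i < y (i + 1)) (hj : y (j + 1) < y j) : y i < y j := by
    by_contra! hji
    obtain ⟨z, hz, hzf⟩ : ∃ z ∈ Set.Icc (y j) (y i), F z - z = 0 := by
      have := intermediate_value_Icc hji (f := fun x => F x - x) (by fun_prop)
      refine this ⟨?_, ?_⟩
      · rw [← h.step]; linarith
      · rw [← h.step]; linarith
    have hzf' : F z = z := sub_eq_zero.1 hzf
    have hzi : z < y i := lt_of_le_of_ne hz.2 (h.ne_of_fixed hzf' i).symm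
    exact absurd (h.fixed_lt hF hno hzf' hzi hi j) (not_lt.2 hz.1)
  set A : Set ℝ := y '' {k | y k < y (k + 1)} with hA
  set B : Set ℝ := y '' {k | y (k + 1) < y k} with hB
  have hAne : A.Nonempty := Set.Nonempty.image _ h.exists_up
  have hBne : B.Nonempty := Set.Nonempty.image _ h.exists_down
  have hAB : ∀ a ∈ A, ∀ b ∈ B, a ≤ b := by
    rintro _ ⟨i, hi, rfl⟩ _ ⟨j, hj, rfl⟩
    exact (hlt hi hj).le
  have hAbdd : BddAbove A := ⟨hBne.some, fun a ha => hAB a ha _ hBne.some_mem⟩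
  have hBbdd : BddBelow B := ⟨hAne.some, fun b hb => hAB _ hAne.some_mem b hb⟩
  have hp : sSup A ≤ F (sSup A) := by
    have hcl : IsClosed {x | x ≤ F x} := isClosed_le continuous_id hF
    refine closure_minimal ?_ hcl (csSup_mem_closure hAne hAbdd)
    rintro _ ⟨i, hi, rfl⟩
    rw [Set.mem_ofPred_eq, ← h.step]
    exact le_of_lt hi
  have hq : F (sInf B) ≤ sInf B := by
    have hcl : IsClosed {x | F x ≤ x} := isClosed_le hF continuous_id
    refine closure_minimal ?_ hcl (csInf_mem_closure hBne hBbdd)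
    rintro _ ⟨i, hi, rfl⟩
    rw [Set.mem_ofPred_eq, ← h.step]
    exact le_of_lt hi
  have hpq : sSup A ≤ sInf B := csSup_le hAne fun a ha => le_csInf hBne fun b hb => hAB a ha b hb
  obtain ⟨z, hz, hzf⟩ := exists_mem_Icc_isFixedPt hF.continuousOn hpq hp hq
  refine ⟨z, hzf, fun k hk => ?_, fun k hk => ?_⟩
  · by_contra! hk'
    have hk'' : y (k + 1) < y k :=
      lt_of_le_of_ne hk' fun hh => absurd (h.injective hh) (by omega)
    exact absurd (csInf_le hBbdd ⟨k, hk'', rfl⟩) (not_le.2 (hk.trans_le hz.2))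
  · by_contra! hk'
    have hk'' : y k < y (k + 1) :=
      lt_of_le_of_ne hk' fun hh => absurd (h.injective hh) (by omega)
    exact absurd (le_csSup hAbdd ⟨k, hk'', rfl⟩) (not_le.2 (hz.1.trans_lt hk))

/-- Without horseshoes, the orbit cannot spend two steps moving up below a fixed point and then
jump above it. -/
lemma not_up_up (h : RecurrentOrbit F y) (hF : Continuous F) (hno : ∀ N, ¬ HasHorseshoe F N)
    {z : ℝ} (hz : F z = z) (j : ℕ) :
    ¬ (y j < y (j + 1) ∧ y (j + 1) < z ∧ z < y (j + 2)) := by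
  rintro ⟨h1, h2, h3⟩
  let V : Set ℝ := {v | v < F v} ∩ {v | F v < z} ∩ {v | z < F (F v)}
  have hVo : IsOpen V := ((isOpen_lt continuous_id hF).inter (isOpen_lt hF continuous_const)).inter
    (isOpen_lt continuous_const (hF.comp hF))
  have hjV : y j ∈ V := by
    rw [h.step (j + 1), h.step j] at h3
    rw [h.step j] at h1 h2
    exact ⟨⟨h1, h2⟩, h3⟩
  obtain ⟨k, hjk, hkV⟩ := frequently_atTop.1 (h.recurrent j _ (hVo.mem_nhds hjV)) (j + 1)
  have hne : y j ≠ y k := fun hh => absurd (h.injective hh) (by omega)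
  obtain ⟨l, i, hil, hiV⟩ : ∃ l i, y l < y i ∧ y i ∈ V := by
    rcases lt_or_gt_of_ne hne with hh | hh
    · exact ⟨j, k, hh, hkV⟩
    · exact ⟨k, j, hh, hjV⟩
  clear h1 h2 h3 hjV hjk hkV hne
  obtain ⟨⟨hab, hbz⟩, hzc⟩ := hiV
  simp only [Set.mem_ofPred_eq] at hab hbz hzc
  obtain ⟨t, hit, ht⟩ := frequently_atTop.1 (h.recurrent l _ (Iio_mem_nhds hil)) (i + 2)
  obtain ⟨n, rfl⟩ := Nat.exists_eq_add_of_le hit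
  have hcn : F^[n] (F (F (y i))) < y i := by
    rw [← h.step, ← h.step, h.iterate]
    exact ht
  set a := y i
  set b := F a
  set c := F b
  obtain ⟨c', hc', hFc'⟩ := intermediate_value_Icc' hzc.le (hF.iterate n).continuousOn
    (show b ∈ Set.Icc (F^[n] c) (F^[n] z) by
      rw [Function.iterate_fixed hz n]
      exact ⟨by linarith, hbz.le⟩)
  have hzc' : z < c' := lt_of_le_of_ne hc'.1 fun hh => by
    rw [← hh, Function.iterate_fixed hz n] at hFc'
    linarith
  obtain ⟨b', hb', hFb'⟩ := intermediate_value_Icc' hbz.le hF.continuousOn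
    (show c' ∈ Set.Icc (F z) (F b) from ⟨by rw [hz]; exact hc'.1, hc'.2⟩)
  have hb'z : b' ≤ z := hb'.2
  have covC : Set.Icc a b ⊆ F^[n] '' Set.Icc c' c := by
    have := intermediate_value_Icc' hc'.2 (hF.iterate n).continuousOn
    rw [hFc'] at this
    exact (Set.Icc_subset_Icc_left hcn.le).trans this
  have covB : Set.Icc c' c ⊆ F '' Set.Icc b b' := by
    have := intermediate_value_Icc' hb'.1 hF.continuousOn
    rwa [hFb'] at this
  have covA : Set.Icc b c ⊆ F '' Set.Icc a b := intermediate_value_Icc hab.le hF.continuousOn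
  have hBsub : Set.Icc b b' ⊆ Set.Icc b c :=
    Set.Icc_subset_Icc_right (hb'z.trans hzc.le)
  have hCsub : Set.Icc c' c ⊆ Set.Icc b c := Set.Icc_subset_Icc_left (hbz.le.trans hzc'.le)
  have hun : Set.Icc a b ∩ F ⁻¹' Set.Icc c' c ∪ Set.Icc a b ∩ F ⁻¹' Set.Icc b b' ⊆
      Set.Icc a b := Set.union_subset Set.inter_subset_left Set.inter_subset_left
  have e1 (x : ℝ) : F^[n + 1 + (n + 2)] x = F^[n] (F (F (F^[n] (F x)))) := by
    rw [add_comm (n + 1), Function.iterate_add_apply F (n + 2), Function.iterate_add_apply F n 2,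
      Function.iterate_add_apply F n 1]
    rfl
  have e2 (x : ℝ) : F^[n + 1 + (n + 2)] x = F^[n] (F (F^[n] (F (F x)))) := by
    rw [Function.iterate_add_apply F (n + 1), Function.iterate_add_apply F n 2,
      Function.iterate_add_apply F n 1]
    rfl
  have covJ : Set.Icc a b ⊆ F^[n + 1 + (n + 2)] '' (Set.Icc a b ∩ F ⁻¹' Set.Icc c' c) := by
    intro x hx
    obtain ⟨x1, hx1, rfl⟩ := covC hx
    obtain ⟨x2, hx2, rfl⟩ := covB hx1
    obtain ⟨x3, hx3, rfl⟩ := covA (hBsub hx2)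
    obtain ⟨x4, hx4, rfl⟩ := covC hx3
    obtain ⟨x5, hx5, rfl⟩ := covA (hCsub hx4)
    exact ⟨x5, ⟨hx5, hx4⟩, e1 x5⟩
  have covK : Set.Icc a b ⊆ F^[n + 1 + (n + 2)] '' (Set.Icc a b ∩ F ⁻¹' Set.Icc b b') := by
    intro x hx
    obtain ⟨x1, hx1, rfl⟩ := covC hx
    obtain ⟨x2, hx2, rfl⟩ := covA (hCsub hx1)
    obtain ⟨x3, hx3, rfl⟩ := covC hx2
    obtain ⟨x4, hx4, rfl⟩ := covB hx3
    obtain ⟨x5, hx5, rfl⟩ := covA (hBsub hx4)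
    exact ⟨x5, ⟨hx5, hx4⟩, e2 x5⟩
  refine hno (n + 1 + (n + 2)) ⟨_, _, isCompact_Icc.inter_right (isClosed_Icc.preimage hF),
    isCompact_Icc.inter_right (isClosed_Icc.preimage hF), ?_, ?_, hun.trans covJ, hun.trans covK⟩
  · rw [Set.disjoint_left]
    rintro x ⟨_, hx⟩ ⟨_, hx'⟩
    have h1 : c' ≤ F x := hx.1
    have h2 : F x ≤ b' := hx'.2
    linarith
  · obtain ⟨x, hx, _⟩ := covJ (Set.left_mem_Icc.2 hab.le)
    exact ⟨x, hx⟩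

lemma not_below_below (h : RecurrentOrbit F y) (hF : Continuous F)
    (hno : ∀ N, ¬ HasHorseshoe F N) {z : ℝ} (hz : F z = z)
    (hup : ∀ k, y k < z → y k < y (k + 1)) (k : ℕ) :
    ¬ (y k < z ∧ y (k + 1) < z) := by
  rintro ⟨h0, h1⟩
  have hall (n : ℕ) : y (k + n) < z ∧ y (k + n + 1) < z := by
    induction n with
    | zero => exact ⟨h0, h1⟩
    | succ n ih =>
      refine ⟨ih.2, ?_⟩
      by_contra! hge
      exact h.not_up_up hF hno hz (k + n)
        ⟨hup _ ih.1, ih.2, lt_of_le_of_ne hge (h.ne_of_fixed hz _).symm⟩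
  obtain ⟨d, hd⟩ := h.exists_down
  have hzd : z < y d := by
    by_contra! hle
    exact absurd (hup d (lt_of_le_of_ne hle (h.ne_of_fixed hz d))) (not_lt.2 hd.le)
  obtain ⟨t, hkt, ht⟩ := frequently_atTop.1 (h.recurrent d _ (Ioi_mem_nhds hzd)) k
  obtain ⟨n, rfl⟩ := Nat.exists_eq_add_of_le hkt
  exact absurd (hall n).1 (not_lt.2 (le_of_lt ht))

/-- Without horseshoes, the points of an infinite recurrent orbit alternate between the two sides
of some point. -/
theorem exists_separation (h : RecurrentOrbit F y) (hF : Continuous F)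
    (hno : ∀ N, ¬ HasHorseshoe F N) :
    ∃ z, (∀ k, y (2 * k) < z ∧ z < y (2 * k + 1)) ∨ ∀ k, z < y (2 * k) ∧ y (2 * k + 1) < z := by
  obtain ⟨z, hz, hup, hdown⟩ := h.exists_fixed hF hno
  have hne (k : ℕ) := h.ne_of_fixed hz k
  have h1 (k : ℕ) (hk : y k < z) : z < y (k + 1) := by
    by_contra! hle
    exact h.not_below_below hF hno hz hup k ⟨hk, lt_of_le_of_ne hle (hne _)⟩
  have h2 (k : ℕ) (hk : z < y k) : y (k + 1) < z := by
    by_contra! hle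
    refine h.neg.not_below_below (by fun_prop) (fun N hN => hno N hN.of_neg) (z := -z)
      (by simp [hz]) (fun k hk => ?_) k ⟨?_, ?_⟩
    · simpa using hdown k (by simpa using hk)
    · simpa using hk
    · simpa using lt_of_le_of_ne hle (hne _).symm
  refine ⟨z, ?_⟩
  rcases lt_or_gt_of_ne (hne 0) with h0 | h0
  · left
    intro k
    induction k with
    | zero => exact ⟨h0, h1 0 h0⟩
    | succ k ih => exact ⟨h2 _ ih.2, h1 _ (h2 _ ih.2)⟩
  · right
    intro k
    induction k with
    | zero => exact ⟨h0, h2 0 h0⟩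
    | succ k ih => exact ⟨h1 _ ih.2, h2 _ (h1 _ ih.2)⟩

end RecurrentOrbit

lemma sum_range_add_of_periodic {E : Type*} [AddCommGroup E] {u : ℕ → E} {M : ℕ}
    (hu : ∀ k, u (k + M) = u k) (k : ℕ) :
    ∑ j ∈ Finset.range M, u (k + j) = ∑ j ∈ Finset.range M, u j := by
  induction k with
  | zero => simp
  | succ k ih =>
    have h1 := Finset.sum_range_succ (fun j => u (k + j)) M
    have h2 := Finset.sum_range_succ' (fun j => u (k + j)) M
    rw [h1, hu, add_zero, add_left_inj] at h2
    rw [← ih, h2]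
    exact Finset.sum_congr rfl fun j _ => by rw [add_assoc, add_comm 1 j]

/-- A compact interval covered by the image of another one is the exact image of a
subinterval. -/
lemma exists_subinterval_image_eq {G : ℝ → ℝ} (hG : Continuous G) {u v c d : ℝ} (hcd : c ≤ d)
    (h : Set.Icc c d ⊆ G '' Set.Icc u v) :
    ∃ u' v', u' ≤ v' ∧ Set.Icc u' v' ⊆ Set.Icc u v ∧ G '' Set.Icc u' v' = Set.Icc c d := by
  -- it suffices to find endpoints mapped to the endpoints, with no such points in between
  have main : ∀ {G : ℝ → ℝ}, Continuous G → ∀ {α β c d : ℝ}, α ≤ β → c ≤ d → G α = c → G β = d →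
      ∃ u' v', u' ≤ v' ∧ Set.Icc u' v' ⊆ Set.Icc α β ∧ G '' Set.Icc u' v' = Set.Icc c d := by
    intro G hG α β c d hαβ hcd hα hβ
    set S := Set.Icc α β ∩ G ⁻¹' {d}
    have hS : IsCompact S := isCompact_Icc.inter_right (isClosed_singleton.preimage hG)
    have hSne : S.Nonempty := ⟨β, Set.right_mem_Icc.2 hαβ, hβ⟩
    obtain ⟨v', ⟨hv', hGv'⟩, hvmin⟩ := hS.exists_isLeast hSne
    set T := Set.Icc α v' ∩ G ⁻¹' {c}
    have hT : IsCompact T := isCompact_Icc.inter_right (isClosed_singleton.preimage hG)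
    have hTne : T.Nonempty := ⟨α, Set.left_mem_Icc.2 hv'.1, hα⟩
    obtain ⟨u', ⟨hu', hGu'⟩, humax⟩ := hT.exists_isGreatest hTne
    rw [Set.mem_preimage, Set.mem_singleton_iff] at hGv' hGu'
    refine ⟨u', v', hu'.2, Set.Icc_subset_Icc hu'.1 hv'.2, Set.Subset.antisymm ?_ ?_⟩
    · rintro _ ⟨t, ht, rfl⟩
      have hdt : d < G t → False := fun hdt => by
        obtain ⟨s, hs, hGs⟩ := intermediate_value_Icc ht.1 hG.continuousOn
          (show d ∈ Set.Icc (G u') (G t) from ⟨by rw [hGu']; exact hcd, hdt.le⟩)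
        have hvs : v' ≤ s := hvmin ⟨⟨hu'.1.trans hs.1, hs.2.trans (ht.2.trans hv'.2)⟩, hGs⟩
        have hst : s = t := le_antisymm hs.2 (ht.2.trans hvs)
        rw [hst] at hGs
        exact absurd hGs hdt.ne'
      have hct : G t < c → False := fun hct => by
        obtain ⟨s, hs, hGs⟩ := intermediate_value_Icc ht.2 hG.continuousOn
          (show c ∈ Set.Icc (G t) (G v') from ⟨hct.le, by rw [hGv']; exact hcd⟩)
        have hsu : s ≤ u' := humax ⟨⟨hu'.1.trans (ht.1.trans hs.1), hs.2⟩, hGs⟩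
        have hst : s = t := le_antisymm (hsu.trans ht.1) hs.1
        rw [hst] at hGs
        exact absurd hGs hct.ne
      exact ⟨not_lt.1 hct, not_lt.1 hdt⟩
    · have := intermediate_value_Icc hu'.2 hG.continuousOn
      rwa [hGu', hGv'] at this
  obtain ⟨α, hα, hGα⟩ := h (Set.left_mem_Icc.2 hcd)
  obtain ⟨β, hβ, hGβ⟩ := h (Set.right_mem_Icc.2 hcd)
  rcases le_total α β with hαβ | hαβ
  · obtain ⟨u', v', h1, h2, h3⟩ := main hG hαβ hcd hGα hGβ
    exact ⟨u', v', h1, h2.trans (Set.Icc_subset_Icc hα.1 hβ.2), h3⟩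
  · obtain ⟨u', v', h1, h2, h3⟩ := main (G := fun x => -G x) hG.neg hαβ (neg_le_neg hcd)
      (by simp [hGβ]) (by simp [hGα])
    refine ⟨u', v', h1, h2.trans (Set.Icc_subset_Icc hβ.1 hα.2), ?_⟩
    have h4 : (fun x => -G x) '' Set.Icc u' v' = -(G '' Set.Icc u' v') := by
      rw [← Set.image_neg_eq_neg, Set.image_image]
    rw [h4, ← Set.neg_Icc, neg_inj] at h3
    exact h3

/-- A chain of coverings of compact intervals is followed by a subinterval of the first one. -/
lemma exists_subinterval_of_chain {F : ℝ → ℝ} (hF : Continuous F) {a b : ℕ → ℝ}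
    (hab : ∀ i, a i ≤ b i)
    (hcov : ∀ i, Set.Icc (a (i + 1)) (b (i + 1)) ⊆ F '' Set.Icc (a i) (b i)) (n : ℕ) :
    ∃ u v, u ≤ v ∧ Set.Icc u v ⊆ Set.Icc (a 0) (b 0) ∧
      (∀ j ≤ n, Set.MapsTo F^[j] (Set.Icc u v) (Set.Icc (a j) (b j))) ∧
      F^[n] '' Set.Icc u v = Set.Icc (a n) (b n) := by
  induction n with
  | zero =>
    refine ⟨a 0, b 0, hab 0, subset_rfl, fun j hj => ?_, by simp⟩
    obtain rfl : j = 0 := by omega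
    exact Set.mapsTo_id _
  | succ n ih =>
    obtain ⟨u, v, _, hsub, hmaps, himg⟩ := ih
    have hc : Set.Icc (a (n + 1)) (b (n + 1)) ⊆ F^[n + 1] '' Set.Icc u v := by
      rw [Function.iterate_succ', Set.image_comp, himg]
      exact hcov n
    obtain ⟨u', v', huv', hsub', himg'⟩ :=
      exists_subinterval_image_eq (hF.iterate (n + 1)) (hab (n + 1)) hc
    refine ⟨u', v', huv', hsub'.trans hsub, fun j hj => ?_, himg'⟩
    rcases Nat.lt_succ_iff_lt_or_eq.1 (Nat.lt_succ_of_le hj) with hj' | rfl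
    · exact (hmaps j (by omega)).mono_left hsub'
    · exact Set.mapsTo_iff_image_subset.2 himg'.subset

/-- `x` is an infinite orbit of `F` in `[0, 1]` whose starting point is recurrent for every iterate
of `F`. -/
structure TotallyRecurrentOrbit (F : ℝ → ℝ) (x : ℕ → ℝ) : Prop where
  mem_Icc : ∀ k, x k ∈ Set.Icc (0 : ℝ) 1
  step : ∀ k, x (k + 1) = F (x k)
  injective : Function.Injective x
  recurrent : ∀ n, 0 < n → ∀ V ∈ 𝓝 (x 0), ∃ᶠ k in atTop, x (n * k) ∈ V

/-- The points of the sequence `x` whose indices are at least `i` and congruent to `i` modulo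
`n`. -/
def residueOrbit (x : ℕ → ℝ) (n i : ℕ) : Set ℝ := Set.range fun k => x (i + n * k)

/-- The length of the convex hull of `residueOrbit x n i`. -/
noncomputable def residueLength (x : ℕ → ℝ) (n i : ℕ) : ℝ :=
  sSup (residueOrbit x n i) - sInf (residueOrbit x n i)

namespace TotallyRecurrentOrbit

variable {F : ℝ → ℝ} {x : ℕ → ℝ}

lemma iterate (h : TotallyRecurrentOrbit F x) (n k : ℕ) : F^[n] (x k) = x (k + n) := by
  induction n with
  | zero => rfl
  | succ n ih => rw [Function.iterate_succ_apply', ih, ← h.step]; rfl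

lemma recurrentOrbit (h : TotallyRecurrentOrbit F x) (hF : Continuous F) {n : ℕ} (hn : 0 < n)
    (i : ℕ) : RecurrentOrbit F^[n] (fun k => x (i + n * k)) where
  step k := by rw [h.iterate]; congr 1; ring
  injective k l hkl := by
    have := h.injective hkl
    exact Nat.eq_of_mul_eq_mul_left hn (by omega)
  recurrent j V hV := by
    have hpre : F^[i + n * j] ⁻¹' V ∈ 𝓝 (x 0) := by
      refine (hF.iterate _).continuousAt.preimage_mem_nhds ?_
      rwa [h.iterate, zero_add]
    rw [frequently_atTop]
    intro N
    obtain ⟨k, hk, hkV⟩ := frequently_atTop.1 (h.recurrent n hn _ hpre) N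
    refine ⟨k + j, by omega, ?_⟩
    rw [Set.mem_preimage, h.iterate] at hkV
    convert hkV using 2
    ring

lemma residueOrbit_subset (h : TotallyRecurrentOrbit F x) (n i : ℕ) :
    residueOrbit x n i ⊆ Set.Icc 0 1 := by
  rintro _ ⟨k, rfl⟩
  exact h.mem_Icc _

lemma residueOrbit_subset_Icc (h : TotallyRecurrentOrbit F x) (n i : ℕ) :
    residueOrbit x n i ⊆ Set.Icc (sInf (residueOrbit x n i)) (sSup (residueOrbit x n i)) :=
  subset_Icc_csInf_csSup (bddBelow_Icc.mono (h.residueOrbit_subset n i))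
    (bddAbove_Icc.mono (h.residueOrbit_subset n i))

lemma residueLength_add_le (h : TotallyRecurrentOrbit F x) (hF : Continuous F)
    (hno : ∀ N, ¬ HasHorseshoe F N) {n : ℕ} (hn : 0 < n) (i : ℕ) :
    residueLength x (n + n) i + residueLength x (n + n) (i + n) ≤ residueLength x n i := by
  have hsub1 : residueOrbit x (n + n) i ⊆ residueOrbit x n i := by
    rintro _ ⟨k, rfl⟩
    exact ⟨2 * k, by dsimp only; congr 1; ring⟩
  have hsub2 : residueOrbit x (n + n) (i + n) ⊆ residueOrbit x n i := by
    rintro _ ⟨k, rfl⟩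
    exact ⟨2 * k + 1, by dsimp only; congr 1; ring⟩
  have hbelow := bddBelow_Icc.mono (h.residueOrbit_subset n i)
  have habove := bddAbove_Icc.mono (h.residueOrbit_subset n i)
  have hne (j : ℕ) : (residueOrbit x (n + n) j).Nonempty := Set.range_nonempty _
  have i1 := csInf_le_csInf hbelow (hne i) hsub1
  have i2 := csInf_le_csInf hbelow (hne (i + n)) hsub2
  have s1 := csSup_le_csSup habove (hne i) hsub1
  have s2 := csSup_le_csSup habove (hne (i + n)) hsub2
  have hno' : ∀ N, ¬ HasHorseshoe F^[n] N := fun N hN => hno (n * N) <| by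
    unfold HasHorseshoe at hN ⊢
    rwa [Function.iterate_mul]
  have e1 (k : ℕ) : i + n * (2 * k) = i + (n + n) * k := by ring
  have e2 (k : ℕ) : i + n * (2 * k + 1) = i + n + (n + n) * k := by ring
  obtain ⟨z, hz | hz⟩ := (h.recurrentOrbit hF hn i).exists_separation (hF.iterate n) hno'
  · have t1 : sSup (residueOrbit x (n + n) i) ≤ z := csSup_le (hne _) <| by
      rintro _ ⟨k, rfl⟩
      simpa only [e1] using (hz k).1.le
    have t2 : z ≤ sInf (residueOrbit x (n + n) (i + n)) := le_csInf (hne _) <| by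
      rintro _ ⟨k, rfl⟩
      simpa only [e2] using (hz k).2.le
    unfold residueLength
    linarith
  · have t1 : z ≤ sInf (residueOrbit x (n + n) i) := le_csInf (hne _) <| by
      rintro _ ⟨k, rfl⟩
      simpa only [e1] using (hz k).1.le
    have t2 : sSup (residueOrbit x (n + n) (i + n)) ≤ z := csSup_le (hne _) <| by
      rintro _ ⟨k, rfl⟩
      simpa only [e2] using (hz k).2.le
    unfold residueLength
    linarith

lemma sum_residueLength_le (h : TotallyRecurrentOrbit F x) (hF : Continuous F)
    (hno : ∀ N, ¬ HasHorseshoe F N) (m : ℕ) :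
    ∑ i ∈ Finset.range (2 ^ m), residueLength x (2 ^ m) i ≤ 1 := by
  induction m with
  | zero =>
    have hsub := h.residueOrbit_subset 1 0
    have hne : (residueOrbit x 1 0).Nonempty := Set.range_nonempty _
    have h1 : sSup (residueOrbit x 1 0) ≤ 1 := csSup_le hne fun t ht => (hsub ht).2
    have h2 : 0 ≤ sInf (residueOrbit x 1 0) := le_csInf hne fun t ht => (hsub ht).1
    simp only [pow_zero, Finset.sum_range_one, residueLength]
    linarith
  | succ m ih =>
    refine le_trans ?_ ih
    rw [pow_succ, mul_two, Finset.sum_range_add, ← Finset.sum_add_distrib]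
    refine Finset.sum_le_sum fun i _ => ?_
    rw [add_comm (2 ^ m) i]
    exact h.residueLength_add_le hF hno (by positivity) i

lemma Icc_subset_image (h : TotallyRecurrentOrbit F x) (hF : Continuous F) (n i : ℕ) :
    Set.Icc (sInf (residueOrbit x n (i + 1))) (sSup (residueOrbit x n (i + 1))) ⊆
      F '' Set.Icc (sInf (residueOrbit x n i)) (sSup (residueOrbit x n i)) := by
  set I := Set.Icc (sInf (residueOrbit x n i)) (sSup (residueOrbit x n i))
  have hsub : residueOrbit x n (i + 1) ⊆ F '' I := by
    rintro _ ⟨k, rfl⟩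
    refine ⟨x (i + n * k), h.residueOrbit_subset_Icc n i ⟨k, rfl⟩, ?_⟩
    rw [← h.step]
    dsimp only
    congr 1
    ring
  have hclosed : IsClosed (F '' I) := (isCompact_Icc.image hF).isClosed
  have hconn : (F '' I).OrdConnected := (isPreconnected_Icc.image F hF.continuousOn).ordConnected
  have hne : (residueOrbit x n (i + 1)).Nonempty := Set.range_nonempty _
  have hcl := closure_minimal hsub hclosed
  exact hconn.out
    (hcl (csInf_mem_closure hne (bddBelow_Icc.mono (h.residueOrbit_subset n (i + 1)))))
    (hcl (csSup_mem_closure hne (bddAbove_Icc.mono (h.residueOrbit_subset n (i + 1)))))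

/-- Without horseshoes, the orbit is shadowed in the mean by periodic orbits of period `2 ^ m`. -/
theorem exists_periodic_shadowing (h : TotallyRecurrentOrbit F x) (hF : Continuous F)
    (hno : ∀ N, ¬ HasHorseshoe F N) (m : ℕ) :
    ∃ p ∈ Set.Icc (0 : ℝ) 1, F^[2 ^ m] p = p ∧
      ∀ k, ∑ j ∈ Finset.range (2 ^ m), |x (k + j) - F^[k + j] p| ≤ 1 := by
  set M := 2 ^ m with hM
  have hMpos : 0 < M := by positivity
  set a : ℕ → ℝ := fun i => sInf (residueOrbit x M i)
  set b : ℕ → ℝ := fun i => sSup (residueOrbit x M i)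
  have hne (i : ℕ) : (residueOrbit x M i).Nonempty := Set.range_nonempty _
  have hmem (i : ℕ) : residueOrbit x M i ⊆ Set.Icc (a i) (b i) := h.residueOrbit_subset_Icc M i
  have hab (i : ℕ) : a i ≤ b i := by
    obtain ⟨t, ht⟩ := hne i
    exact (hmem i ht).1.trans (hmem i ht).2
  obtain ⟨u, v, huv, hsub, hmaps, himg⟩ :=
    exists_subinterval_of_chain hF hab (h.Icc_subset_image hF M) M
  have hx0 : x 0 ∈ Set.Icc (a M) (b M) := by
    have hcl : x 0 ∈ closure (residueOrbit x M M) := by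
      rw [mem_closure_iff_nhds]
      intro V hV
      obtain ⟨k, hk, hkV⟩ := frequently_atTop.1 (h.recurrent M hMpos V hV) 1
      obtain ⟨l, rfl⟩ := Nat.exists_eq_add_of_le hk
      exact ⟨_, hkV, l, by dsimp only; congr 1; ring⟩
    exact closure_minimal (hmem M) isClosed_Icc hcl
  have h0M : residueOrbit x M 0 ⊆ Set.Icc (a M) (b M) := by
    rintro _ ⟨k, rfl⟩
    cases k with
    | zero => simpa using hx0
    | succ k => exact hmem M ⟨k, by dsimp only; congr 1; ring⟩
  have hIcc : Set.Icc (a 0) (b 0) ⊆ Set.Icc (a M) (b M) :=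
    Set.Icc_subset_Icc (le_csInf (hne 0) fun t ht => (h0M ht).1)
      (csSup_le (hne 0) fun t ht => (h0M ht).2)
  have hsurj : Set.SurjOn F^[M] (Set.Icc u v) (Set.Icc u v) := by
    rw [Set.SurjOn, himg]
    exact hsub.trans hIcc
  obtain ⟨p, hp, hpfix⟩ := exists_mem_Icc_isFixedPt_of_surjOn (hF.iterate M).continuousOn huv hsurj
  have hpfix' : F^[M] p = p := hpfix
  have hper (k : ℕ) : F^[k + M] p = F^[k] p := by rw [Function.iterate_add_apply, hpfix']
  have hmod (k : ℕ) : F^[k % M] p = F^[k] p :=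
    Function.Periodic.map_mod_nat (f := fun k => F^[k] p) hper k
  refine ⟨p, ?_, hpfix', fun k => ?_⟩
  · have h0 : 0 ≤ a 0 := le_csInf (hne 0) fun t ht => (h.residueOrbit_subset M 0 ht).1
    have h1 : b 0 ≤ 1 := csSup_le (hne 0) fun t ht => (h.residueOrbit_subset M 0 ht).2
    exact ⟨h0.trans (hsub hp).1, (hsub hp).2.trans h1⟩
  · have hterm (l : ℕ) : |x l - F^[l] p| ≤ residueLength x M (l % M) := by
      have h1 : x l ∈ Set.Icc (a (l % M)) (b (l % M)) :=
        hmem _ ⟨l / M, by dsimp only; rw [Nat.mod_add_div]⟩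
      have h2 : F^[l] p ∈ Set.Icc (a (l % M)) (b (l % M)) := by
        rw [← hmod]
        exact hmaps _ (Nat.mod_lt l hMpos).le hp
      exact abs_sub_le_iff.2 ⟨sub_le_sub h1.2 h2.1, sub_le_sub h2.2 h1.1⟩
    calc ∑ j ∈ Finset.range M, |x (k + j) - F^[k + j] p|
        ≤ ∑ j ∈ Finset.range M, residueLength x M ((k + j) % M) :=
          Finset.sum_le_sum fun j _ => hterm _
      _ = ∑ j ∈ Finset.range M, residueLength x M (j % M) :=
          sum_range_add_of_periodic (u := fun l => residueLength x M (l % M))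
            (fun l => by simp) k
      _ = ∑ j ∈ Finset.range M, residueLength x M j :=
          Finset.sum_congr rfl fun j hj => by rw [Nat.mod_eq_of_lt (Finset.mem_range.1 hj)]
      _ ≤ 1 := h.sum_residueLength_le hF hno m

end TotallyRecurrentOrbit

lemma integral_avgDirac {X : Type*} [MetricSpace X] [MeasurableSpace X] [BorelSpace X]
    {φ : X → ℝ} (x : ℕ → X) {n : ℕ} (hn : 0 < n) :
    ∫ t, φ t ∂(avgDirac x n).toMeasure = (n : ℝ)⁻¹ * ∑ i ∈ Finset.range n, φ (x i) := by
  have hmax : max n 1 = n := max_eq_left hn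
  simp only [avgDirac, ProbabilityMeasure.coe_mk, hmax]
  rw [integral_smul_measure, integral_finsetSum_measure fun i _ => integrable_dirac (by simp)]
  simp

/-- For almost every starting point, the orbit of an ergodic map accumulates at almost every
point. -/
lemma Ergodic.ae_ae_mapClusterPt {X : Type*} [TopologicalSpace X] [SecondCountableTopology X]
    [MeasurableSpace X] [BorelSpace X] {f : X → X} {μ : Measure X} [IsFiniteMeasure μ]
    (h : Ergodic f μ) : ∀ᵐ x ∂μ, ∀ᵐ y ∂μ, MapClusterPt y atTop fun n => f^[n] x := by
  have hcount := TopologicalSpace.countable_countableBasis X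
  have hx : ∀ᵐ x ∂μ, ∀ s ∈ TopologicalSpace.countableBasis X, μ s ≠ 0 →
      ∃ᶠ n in atTop, f^[n] x ∈ s := by
    refine (ae_ball_iff hcount).2 fun s hs => ?_
    by_cases h0 : μ s = 0
    · exact Eventually.of_forall fun x hx => absurd h0 hx
    have hsm : MeasurableSet s := (TopologicalSpace.isOpen_of_mem_countableBasis hs).measurableSet
    set B : Set X := {x | ∃ᶠ n in atTop, f^[n] x ∈ s} with hB
    have hBm : MeasurableSet B := by
      have : B = limsup (fun n => f^[n] ⁻¹' s) atTop := by
        ext x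
        rw [mem_limsup_iff_frequently_mem]
        rfl
      rw [this]
      exact MeasurableSet.measurableSet_limsup fun n => h.measurable.iterate n hsm
    have hBinv : f ⁻¹' B = B := by
      ext x
      simp only [hB, Set.mem_preimage, Set.mem_ofPred_eq, ← Function.iterate_succ_apply]
      exact Filter.frequently_map (m := fun n => n + 1) (P := fun n => f^[n] x ∈ s) |>.symm.trans
        (by rw [map_add_atTop_eq_nat])
    have hsB : ∀ᵐ x ∂μ, x ∈ s → x ∈ B :=
      h.toMeasurePreserving.conservative.ae_mem_imp_frequently_image_mem hsm.nullMeasurableSet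
    rcases h.toPreErgodic.ae_mem_or_ae_notMem hBm hBinv with hall | hnone
    · exact hall.mono fun x hx _ => hx
    · refine absurd (measure_eq_zero_iff_ae_notMem.2 ?_) h0
      filter_upwards [hsB, hnone] with x h1 h2 h3 using h2 (h1 h3)
  have hy : ∀ᵐ y ∂μ, ∀ s ∈ TopologicalSpace.countableBasis X, μ s = 0 → y ∉ s := by
    refine (ae_ball_iff hcount).2 fun s _ => ?_
    by_cases h0 : μ s = 0
    · exact (measure_eq_zero_iff_ae_notMem.1 h0).mono fun y hy _ => hy
    · exact Eventually.of_forall fun y hy => absurd hy h0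
  filter_upwards [hx] with x hx
  filter_upwards [hy] with y hy
  rw [mapClusterPt_iff_frequently]
  intro V hV
  obtain ⟨s, hs, hys, hsV⟩ := (TopologicalSpace.isBasis_countableBasis X).mem_nhds_iff.1 hV
  exact (hx s hs fun h0 => hy s hs h0 hys).mono fun n hn => hsV hn

/-- If almost every point is an accumulation point of the orbit of `x`, and this orbit is eventually
shadowed in the mean by a periodic orbit, then the invariant measure is close to the measure carried
by the periodic orbit. -/
lemma abs_integral_sub_periodicOrbitMeasure_le {X : Type*} [MetricSpace X] [CompactSpace X]
    [MeasurableSpace X] [BorelSpace X] {f : X → X} (hf : Continuous f) {μ : Measure X}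
    [IsProbabilityMeasure μ] (hμ : MeasurePreserving f μ μ) {x : X}
    (hx : ∀ᵐ y ∂μ, MapClusterPt y atTop fun n => f^[n] x) {p : X} {M : ℕ} (hM : 0 < M)
    (hp : f^[M] p = p) {C : ℝ}
    (hC : ∀ᶠ k in atTop, ∑ j ∈ Finset.range M, dist (f^[k + j] x) (f^[k + j] p) ≤ C)
    {φ : X → ℝ} {L : ℝ≥0} (hφ : LipschitzWith L φ) :
    |∫ y, φ y ∂μ - ∫ y, φ y ∂(periodicOrbitMeasure f p M).toMeasure| ≤ L * C / M := by
  have hMR : (0 : ℝ) < M := by exact_mod_cast hM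
  have hint (j : ℕ) : Integrable (fun y => φ (f^[j] y)) μ :=
    (hφ.continuous.comp (hf.iterate j)).integrable_of_hasCompactSupport
      (HasCompactSupport.of_compactSpace _)
  have hsum : ∫ y, ∑ j ∈ Finset.range M, φ (f^[j] y) ∂μ = M * ∫ y, φ y ∂μ := by
    rw [integral_finsetSum _ fun j _ => hint j]
    have (j : ℕ) : ∫ y, φ (f^[j] y) ∂μ = ∫ y, φ y ∂μ := by
      have hmp := hμ.iterate j
      rw [← integral_map hmp.aemeasurable (hmp.map_eq.symm ▸
        hφ.continuous.aestronglyMeasurable), hmp.map_eq]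
    simp [this]
  set c : ℝ := ∑ j ∈ Finset.range M, φ (f^[j] p) with hc
  have hshift (k : ℕ) : ∑ j ∈ Finset.range M, φ (f^[k + j] p) = c :=
    sum_range_add_of_periodic (u := fun k => φ (f^[k] p))
      (fun k => by rw [Function.iterate_add_apply, hp]) k
  have hae : ∀ᵐ y ∂μ, ‖∑ j ∈ Finset.range M, φ (f^[j] y) - c‖ ≤ L * C := by
    filter_upwards [hx] with y hy
    have hcl : IsClosed {y | ‖∑ j ∈ Finset.range M, φ (f^[j] y) - c‖ ≤ L * C} := by
      refine isClosed_le ?_ continuous_const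
      exact ((continuous_finsetSum _ fun j _ => hφ.continuous.comp (hf.iterate j)).sub
        continuous_const).norm
    by_contra hcon
    refine (mapClusterPt_iff_frequently.1 hy _ (hcl.isOpen_compl.mem_nhds hcon)) ?_
    filter_upwards [hC] with k hk hmem
    refine hmem ?_
    rw [Set.mem_ofPred_eq, ← hshift k, ← Finset.sum_sub_distrib]
    refine (norm_sum_le _ _).trans (le_trans ?_ (mul_le_mul_of_nonneg_left hk L.coe_nonneg))
    rw [Finset.mul_sum]
    refine Finset.sum_le_sum fun j _ => ?_
    rw [← Function.iterate_add_apply, add_comm j k, ← dist_eq_norm]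
    exact hφ.dist_le_mul _ _
  have hbound := norm_integral_le_of_norm_le_const hae
  rw [integral_sub (integrable_finsetSum _ fun j _ => hint j) (integrable_const c), hsum,
    integral_const, probReal_univ, one_smul, mul_one, Real.norm_eq_abs] at hbound
  rw [periodicOrbitMeasure, integral_avgDirac _ hM, ← hc, le_div_iff₀ hMR]
  calc |∫ y, φ y ∂μ - (M : ℝ)⁻¹ * c| * M = |M * ∫ y, φ y ∂μ - c| := by
        nth_rewrite 2 [← abs_of_pos hMR]
        rw [← abs_mul]
        congr 1
        field_simp
    _ ≤ L * C := hbound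

lemma coverEntropy_pos_of_hasHorseshoe_extension {f : Set.Icc (0 : ℝ) 1 → Set.Icc (0 : ℝ) 1} {N : ℕ}
    (h : HasHorseshoe (fun t : ℝ => (f (Set.projIcc 0 1 zero_le_one t) : ℝ)) N) :
    0 < Dynamics.coverEntropy f Set.univ := by
  set F : ℝ → ℝ := fun t => (f (Set.projIcc 0 1 zero_le_one t) : ℝ) with hF
  have hsemi (n : ℕ) (t : Set.Icc (0 : ℝ) 1) : F^[n] t = f^[n] t :=
    ((Function.Semiconj.iterate_right (f := Subtype.val) (ga := f) (gb := F)
      (fun t => by simp [hF]) n) t).symm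
  obtain ⟨J, K, hJ, hK, hd, hne, h1, h2⟩ := h
  have hsub : J ∪ K ⊆ Set.Icc 0 1 := by
    cases N with
    | zero =>
      obtain ⟨t, ht⟩ := hne
      obtain ⟨s, hs, hst⟩ := h2 (Or.inl ht)
      simp only [Function.iterate_zero, id_eq] at hst
      exact absurd (hst ▸ hs) (Set.disjoint_left.1 hd ht)
    | succ n =>
      intro t ht
      obtain ⟨s, _, rfl⟩ := h1 ht
      rw [Function.iterate_succ_apply']
      exact Subtype.property _
  have key {A : Set ℝ} (hA : J ∪ K ⊆ F^[N] '' A) (hA' : A ⊆ J ∪ K) :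
      ((Subtype.val ⁻¹' J ∪ Subtype.val ⁻¹' K : Set (Set.Icc (0 : ℝ) 1))) ⊆
        f^[N] '' (Subtype.val ⁻¹' A) := by
    intro t ht
    obtain ⟨s, hs, hst⟩ := hA ht
    refine ⟨⟨s, hsub (hA' hs)⟩, hs, Subtype.ext ?_⟩
    rw [← hst, ← hsemi]
  have hhs : HasHorseshoe f N := by
    refine ⟨Subtype.val ⁻¹' J, Subtype.val ⁻¹' K,
      (hJ.isClosed.preimage continuous_subtype_val).isCompact,
      (hK.isClosed.preimage continuous_subtype_val).isCompact, hd.preimage _, ?_,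
      key h1 Set.subset_union_left, key h2 Set.subset_union_right⟩
    obtain ⟨t, ht⟩ := hne
    exact ⟨⟨t, hsub (Or.inl ht)⟩, ht⟩
  exact hhs.coverEntropy_pos

/-- A zero entropy interval map has, for each ergodic measure, periodic orbit measures that are
uniformly close to it on Lipschitz functions. -/
lemma exists_perMeasures_abs_integral_sub_le {f : Set.Icc (0 : ℝ) 1 → Set.Icc (0 : ℝ) 1}
    (hf : Continuous f) (hent : Dynamics.coverEntropy f Set.univ = 0)
    {μ : Measure (Set.Icc (0 : ℝ) 1)} [IsProbabilityMeasure μ] (hμ : Ergodic f μ) (m : ℕ) :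
    ∃ ν ∈ perMeasures f Set.univ, ∀ (φ : Set.Icc (0 : ℝ) 1 → ℝ) (L : ℝ≥0), LipschitzWith L φ →
      |∫ y, φ y ∂μ - ∫ y, φ y ∂ν.toMeasure| ≤ L / 2 ^ m := by
  have hmp := hμ.toMeasurePreserving
  have hrec : ∀ᵐ x ∂μ, ∀ n, ∀ V ∈ 𝓝 x, ∃ᶠ k in atTop, (f^[n])^[k] x ∈ V :=
    ae_all_iff.2 fun n => (hmp.iterate n).conservative.ae_frequently_mem_of_mem_nhds
  obtain ⟨x, hx, hxrec⟩ := (hμ.ae_ae_mapClusterPt.and hrec).exists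
  by_cases hinj : Function.Injective fun n => f^[n] x
  · set F : ℝ → ℝ := fun t => (f (Set.projIcc 0 1 zero_le_one t) : ℝ) with hF
    have hFc : Continuous F := continuous_subtype_val.comp (hf.comp continuous_projIcc)
    have hsemi (n : ℕ) (t : Set.Icc (0 : ℝ) 1) : F^[n] t = f^[n] t :=
      ((Function.Semiconj.iterate_right (f := Subtype.val) (ga := f) (gb := F)
        (fun t => by simp [hF]) n) t).symm
    have hno (N : ℕ) : ¬ HasHorseshoe F N := fun hN =>
      (coverEntropy_pos_of_hasHorseshoe_extension hN).ne' hent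
    have horb : TotallyRecurrentOrbit F fun n => (f^[n] x : ℝ) :=
      { mem_Icc := fun k => (f^[k] x).2
        step := fun k => by
          rw [Function.iterate_succ_apply']
          simp [hF]
        injective := Subtype.val_injective.comp hinj
        recurrent := fun n _ V hV => by
          have := hxrec n _ (continuous_subtype_val.continuousAt.preimage_mem_nhds hV)
          simp only [← Function.iterate_mul] at this
          exact this }
    obtain ⟨p, hp, hpfix, hshadow⟩ := horb.exists_periodic_shadowing hFc hno m
    have hpfix' : f^[2 ^ m] ⟨p, hp⟩ = ⟨p, hp⟩ := Subtype.ext ((hsemi _ ⟨p, hp⟩).symm.trans hpfix)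
    refine ⟨_, ⟨⟨p, hp⟩, Set.mem_univ _, 2 ^ m, by positivity, hpfix', rfl⟩, fun φ L hφ => ?_⟩
    have := abs_integral_sub_periodicOrbitMeasure_le hf hmp hx (by positivity) hpfix' (C := 1)
      (Eventually.of_forall fun k => ?_) hφ
    · simpa using this
    · refine le_of_eq_of_le (Finset.sum_congr rfl fun j _ => ?_) (hshadow k)
      rw [Subtype.dist_eq, Real.dist_eq, ← hsemi _ ⟨p, hp⟩]
  · obtain ⟨i, P, hP, hiP⟩ : ∃ i P, 0 < P ∧ f^[P] (f^[i] x) = f^[i] x := by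
      simp only [Function.Injective, not_forall] at hinj
      obtain ⟨i, j, hij, hne⟩ := hinj
      rcases lt_or_gt_of_ne hne with hlt | hlt
      · refine ⟨i, j - i, by omega, ?_⟩
        rw [← Function.iterate_add_apply, Nat.sub_add_cancel hlt.le]
        exact hij.symm
      · refine ⟨j, i - j, by omega, ?_⟩
        rw [← Function.iterate_add_apply, Nat.sub_add_cancel hlt.le]
        exact hij
    set p := f^[i * P - i] (f^[i] x) with hp
    have hpfix : f^[P] p = p := by
      rw [hp, ← Function.iterate_add_apply, add_comm, Function.iterate_add_apply, hiP]
    have hip : f^[i] p = f^[i] x := by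
      rw [hp, ← Function.iterate_add_apply,
        Nat.add_sub_cancel' (Nat.le_mul_of_pos_right i hP), mul_comm, Function.iterate_mul]
      exact Function.iterate_fixed hiP i
    refine ⟨_, ⟨p, Set.mem_univ _, P, hP, hpfix, rfl⟩, fun φ L hφ => ?_⟩
    have := abs_integral_sub_periodicOrbitMeasure_le hf hmp hx hP hpfix (C := 0)
      (eventually_atTop.2 ⟨i, fun k hk => le_of_eq (Finset.sum_eq_zero fun j _ => ?_)⟩) hφ
    · rw [mul_zero, zero_div] at this
      exact this.trans (by positivity)
    · obtain ⟨l, hl⟩ := Nat.exists_eq_add_of_le' (hk.trans (Nat.le_add_right k j))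
      rw [hl, Function.iterate_add_apply, Function.iterate_add_apply f l i p, hip, dist_self]

theorem stmt7 (f : Set.Icc (0 : ℝ) 1 → Set.Icc (0 : ℝ) 1) (hf : Continuous f)
    (hent : Dynamics.coverEntropy f Set.univ = 0) :
    {μ : ProbabilityMeasure (Set.Icc (0 : ℝ) 1) | Ergodic f μ.toMeasure}
      ⊆ closure (perMeasures f Set.univ) := by
  intro μ hμ
  choose ν hν hνμ using fun m => exists_perMeasures_abs_integral_sub_le hf hent hμ m
  refine mem_closure_of_tendsto (f := ν) (b := atTop) ?_ (Eventually.of_forall hν)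
  rw [tendsto_iff_forall_lipschitz_integral_tendsto]
  rintro φ - ⟨L, hφ⟩
  refine tendsto_iff_dist_tendsto_zero.2 (squeeze_zero (fun _ => dist_nonneg) (fun m => ?_)
    (tendsto_const_nhds.div_atTop (tendsto_pow_atTop_atTop_of_one_lt one_lt_two) :
      Tendsto (fun m : ℕ => (L : ℝ) / 2 ^ m) atTop (𝓝 0)))
  rw [dist_comm, Real.dist_eq]
  exact hνμ m φ L hφ
end

section
/- Let f: [0,1] → [0,1] be a continuous map which is not Li–Yorke chaotic. Then f is Per(f)-closable: for every ergodic f-invariant measure μ there is a generic point x for μ such that for any ε > 0 and N ∈ ℕ there exist integers N ≤ p ≤ q ≤ (1+ε)p and a periodic point y with f^q y = y and |f^i y − f^i x| < ε for 0 ≤ i ≤ p−1. -/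
open MeasureTheory Filter Topology
open scoped ENNReal NNReal

/-- `f` is Li–Yorke chaotic. -/
def LiYorkeChaotic {Y : Type*} [MetricSpace Y] (f : Y → Y) : Prop :=
  ∃ S : Set Y, ¬ S.Countable ∧ ∀ x ∈ S, ∀ y ∈ S, x ≠ y →
    0 < limsup (fun n => dist (f^[n] x) (f^[n] y)) atTop ∧
    liminf (fun n => dist (f^[n] x) (f^[n] y)) atTop = 0

/-- `f` has an uncountable set whose distinct points are pairwise proximal and not asymptotic. -/
def HasScrambledSet {Y : Type*} [MetricSpace Y] (f : Y → Y) : Prop :=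
  ∃ S : Set Y, ¬ S.Countable ∧ ∀ x ∈ S, ∀ y ∈ S, x ≠ y →
    (∃ δ > 0, ∃ᶠ n in atTop, δ ≤ dist (f^[n] x) (f^[n] y)) ∧
    ∀ ε > 0, ∃ᶠ n in atTop, dist (f^[n] x) (f^[n] y) < ε

theorem exists_itinerary_s8 {Y : Type*} [MetricSpace Y] {f : Y → Y} (hf : Continuous f)
    {D : ℕ → Set Y} (hD : ∀ k, IsCompact (D k)) (hne : ∀ k, (D k).Nonempty) (t : ℕ → ℕ)
    (hsurj : ∀ k, Set.SurjOn (f^[t k]) (D k) (D (k + 1))) :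
    ∃ x, ∀ k, f^[∑ j ∈ Finset.range k, t j] x ∈ D k := by
  have key : ∀ n, ∀ y ∈ D n, ∃ x, f^[∑ j ∈ Finset.range n, t j] x = y ∧
      ∀ k ≤ n, f^[∑ j ∈ Finset.range k, t j] x ∈ D k := by
    intro n
    induction n with
    | zero =>
      intro y hy
      refine ⟨y, by simp, fun k hk => ?_⟩
      obtain rfl : k = 0 := by omega
      simpa using hy
    | succ n ih =>
      intro y hy
      obtain ⟨w, hw, rfl⟩ := hsurj n hy
      obtain ⟨x, rfl, hx⟩ := ih w hw
      have hx' : f^[∑ j ∈ Finset.range (n + 1), t j] x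
          = f^[t n] (f^[∑ j ∈ Finset.range n, t j] x) := by
        rw [Finset.sum_range_succ, add_comm, Function.iterate_add_apply]
      refine ⟨x, hx', fun k hk => ?_⟩
      rcases hk.lt_or_eq with h | rfl
      · exact hx k (by omega)
      · rwa [hx']
  let X : ℕ → Set Y := fun n => ⋂ k ∈ Set.Iic n, f^[∑ j ∈ Finset.range k, t j] ⁻¹' D k
  have hXc : ∀ n, IsClosed (X n) := fun n =>
    isClosed_biInter fun k _ => (hD k).isClosed.preimage (hf.iterate _)
  have hX0 : IsCompact (X 0) := by
    refine (hD 0).of_isClosed_subset (hXc 0) fun x hx => ?_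
    simpa [X] using hx
  obtain ⟨x, hx⟩ := IsCompact.nonempty_iInter_of_sequence_nonempty_isCompact_isClosed X
    (fun n => Set.biInter_subset_biInter_left (Set.Iic_subset_Iic.2 n.le_succ))
    (fun n => by
      obtain ⟨y, hy⟩ := hne n
      obtain ⟨x, -, hx⟩ := key n y hy
      exact ⟨x, by simpa [X] using hx⟩) hX0 hXc
  refine ⟨x, fun k => ?_⟩
  have := Set.mem_iInter.1 hx k
  simp only [X, Set.mem_iInter, Set.mem_Iic] at this
  exact this k le_rfl

/-- A sequence coding of `σ` repeating each of its digits, and the digit `true`, infinitely often. -/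
def repeatCode (σ : ℕ → Bool) (k : ℕ) : Bool :=
  match k.unpair.1 with
  | 0 => true
  | i + 1 => σ i

theorem HasScrambledSet.of_surjOn {Y : Type*} [MetricSpace Y] {f : Y → Y} (hf : Continuous f)
    {C : ℕ → Bool → Set Y} {γ : Bool → Y} (hγ : γ true ≠ γ false)
    (hC : ∀ k i, IsCompact (C k i)) (hne : ∀ k i, (C k i).Nonempty)
    (hsmall : ∀ ε > 0, ∀ᶠ k in atTop, ∀ i, C k i ⊆ Metric.ball (γ i) ε)
    (t : ℕ → ℕ) (ht : ∀ k, 1 ≤ t k)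
    (hsurj : ∀ k i j, Set.SurjOn (f^[t k]) (C k i) (C (k + 1) j)) : HasScrambledSet f := by
  set T : ℕ → ℕ := fun k => ∑ j ∈ Finset.range k, t j with hT
  have hTk : ∀ k, k ≤ T k := fun k => by
    simpa [hT] using Finset.sum_le_sum fun j (_ : j ∈ Finset.range k) => ht j
  have hpt : ∀ s : ℕ → Bool, ∃ x, ∀ k, f^[T k] x ∈ C k (s k) := fun s =>
    exists_itinerary_s8 hf (D := fun k => C k (s k)) (fun k => hC k _) (fun k => hne k _) t
      fun k => hsurj k _ _
  choose P hP using hpt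
  have hd : 0 < dist (γ true) (γ false) := dist_pos.2 hγ
  have hfar : ∀ σ τ : ℕ → Bool, σ ≠ τ → ∃ᶠ n in atTop, dist (γ true) (γ false) / 3 ≤
      dist (f^[n] (P (repeatCode σ))) (f^[n] (P (repeatCode τ))) := by
    intro σ τ hne
    obtain ⟨i, hi⟩ := Function.ne_iff.1 hne
    obtain ⟨K, hK⟩ := eventually_atTop.1 (hsmall (dist (γ true) (γ false) / 3) (by positivity))
    refine frequently_atTop.2 fun N => ?_
    set k := Nat.pair (i + 1) (max N K) with hk
    have hkN : max N K ≤ k := Nat.right_le_pair _ _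
    refine ⟨T k, le_trans (le_trans (le_max_left _ _) hkN) (hTk k), ?_⟩
    have h1 := hK k (le_trans (le_max_right _ _) hkN) _ (hP (repeatCode σ) k)
    have h2 := hK k (le_trans (le_max_right _ _) hkN) _ (hP (repeatCode τ) k)
    have e1 : repeatCode σ k = σ i := by simp [repeatCode, hk]
    have e2 : repeatCode τ k = τ i := by simp [repeatCode, hk]
    rw [e1, Metric.mem_ball] at h1
    rw [e2, Metric.mem_ball] at h2
    have h3 : dist (γ (σ i)) (γ (τ i)) = dist (γ true) (γ false) := by
      cases h : σ i <;> cases h' : τ i <;> simp_all [dist_comm]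
    have h4 := dist_triangle4 (γ (σ i)) (f^[T k] (P (repeatCode σ)))
      (f^[T k] (P (repeatCode τ))) (γ (τ i))
    rw [dist_comm (γ (σ i)) (f^[T k] (P (repeatCode σ)))] at h4
    linarith
  have hinj : Function.Injective fun σ => P (repeatCode σ) := by
    intro σ τ h
    by_contra hne
    obtain ⟨n, hn⟩ := (hfar σ τ hne).exists
    simp only at h
    rw [h, dist_self] at hn
    linarith
  refine ⟨Set.range fun σ => P (repeatCode σ), fun hc => ?_, ?_⟩
  · have : Countable (ℕ → Bool) := by
      have := hc.to_subtype
      exact (Equiv.ofInjective _ hinj).countable_iff.2 this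
    obtain ⟨g, hg⟩ := exists_injective_nat (ℕ → Bool)
    exact Function.cantor_injective (fun s : Set ℕ => g fun n => by classical exact decide (n ∈ s))
      fun a b hab => by
        ext n
        simpa using congrFun (hg hab) n
  · rintro _ ⟨σ, rfl⟩ _ ⟨τ, rfl⟩ hne
    refine ⟨⟨_, by positivity, hfar σ τ fun h => hne (by rw [h])⟩, fun ε hε => ?_⟩
    obtain ⟨K, hK⟩ := eventually_atTop.1 (hsmall (ε / 2) (by positivity))
    refine frequently_atTop.2 fun N => ?_
    set k := Nat.pair 0 (max N K) with hk
    have hkN : max N K ≤ k := Nat.right_le_pair _ _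
    refine ⟨T k, le_trans (le_trans (le_max_left _ _) hkN) (hTk k), ?_⟩
    have h1 := hK k (le_trans (le_max_right _ _) hkN) _ (hP (repeatCode σ) k)
    have h2 := hK k (le_trans (le_max_right _ _) hkN) _ (hP (repeatCode τ) k)
    have e1 : repeatCode σ k = true := by simp [repeatCode, hk]
    have e2 : repeatCode τ k = true := by simp [repeatCode, hk]
    rw [e1, Metric.mem_ball] at h1
    rw [e2, Metric.mem_ball] at h2
    have h4 := dist_triangle_right (f^[T k] (P (repeatCode σ))) (f^[T k] (P (repeatCode τ)))
      (γ true)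
    linarith

theorem LiYorkeChaotic.of_hasScrambledSet {Y : Type*} [MetricSpace Y] [BoundedSpace Y] {f : Y → Y}
    (h : HasScrambledSet f) : LiYorkeChaotic f := by
  obtain ⟨S, hS, h⟩ := h
  refine ⟨S, hS, fun x hx y hy hxy => ?_⟩
  obtain ⟨⟨δ, hδ, h1⟩, h2⟩ := h x hx y hy hxy
  have hb : IsBoundedUnder (· ≤ ·) atTop fun n => dist (f^[n] x) (f^[n] y) :=
    isBoundedUnder_of ⟨Metric.diam (Set.univ : Set Y), fun n =>
      Metric.dist_le_diam_of_mem (Bornology.IsBounded.all _) trivial trivial⟩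
  have hb' : IsBoundedUnder (· ≥ ·) atTop fun n => dist (f^[n] x) (f^[n] y) :=
    isBoundedUnder_of ⟨0, fun n => dist_nonneg⟩
  refine ⟨hδ.trans_le (le_limsup_of_frequently_le h1 hb), le_antisymm ?_ ?_⟩
  · refine le_of_forall_pos_le_add fun ε hε => ?_
    rw [zero_add]
    exact liminf_le_of_frequently_le ((h2 ε hε).mono fun _ h => h.le) hb'
  · exact le_liminf_of_le hb.isCoboundedUnder_ge (Eventually.of_forall fun _ => dist_nonneg)

theorem HasScrambledSet.of_iccExtend {f : Set.Icc (0 : ℝ) 1 → Set.Icc (0 : ℝ) 1}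
    (h : HasScrambledSet (Set.IccExtend zero_le_one fun x => (f x : ℝ))) : HasScrambledSet f := by
  set F := Set.IccExtend zero_le_one fun x => (f x : ℝ) with hF
  set π := Set.projIcc (0 : ℝ) 1 zero_le_one
  have hit : ∀ (n : ℕ) (x : ℝ), F^[n + 1] x = f^[n + 1] (π x) := by
    intro n x
    induction n with
    | zero => rfl
    | succ n ih =>
      rw [Function.iterate_succ_apply', ih, Function.iterate_succ_apply' f (n + 1), hF,
        Set.IccExtend_val]
  have hdist : ∀ x y, ∀ᶠ n in atTop,
      dist (F^[n] x) (F^[n] y) = dist (f^[n] (π x)) (f^[n] (π y)) := fun x y => by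
    filter_upwards [eventually_ge_atTop 1] with n hn
    obtain ⟨m, rfl⟩ := Nat.exists_eq_add_of_le' hn
    rw [hit, hit, Subtype.dist_eq]
  obtain ⟨S, hS, h⟩ := h
  have hinj : Set.InjOn π S := fun x hx y hy hxy => by
    by_contra hne
    obtain ⟨⟨δ, hδ, h1⟩, -⟩ := h x hx y hy hne
    obtain ⟨n, hn, hn'⟩ := (h1.and_eventually (hdist x y)).exists
    rw [hn', hxy, dist_self] at hn
    linarith
  refine ⟨π '' S, fun hc => hS ?_, ?_⟩
  · exact Set.countable_of_injective_of_countable_image hinj hc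
  · rintro _ ⟨x, hx, rfl⟩ _ ⟨y, hy, rfl⟩ hxy
    obtain ⟨⟨δ, hδ, h1⟩, h2⟩ := h x hx y hy fun e => hxy (by rw [e])
    exact ⟨⟨δ, hδ, (h1.and_eventually (hdist x y)).mono fun n hn => hn.2 ▸ hn.1⟩,
      fun ε hε => ((h2 ε hε).and_eventually (hdist x y)).mono fun n hn => hn.2 ▸ hn.1⟩

/-- The conjugate of a real map by `x ↦ -x`. -/
def negConj (f : ℝ → ℝ) (x : ℝ) : ℝ := -f (-x)

theorem negConj_iterate (f : ℝ → ℝ) (n : ℕ) (x : ℝ) : (negConj f)^[n] x = -f^[n] (-x) := by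
  induction n generalizing x with
  | zero => simp
  | succ n ih => simp [ih, negConj]

theorem Continuous.negConj {f : ℝ → ℝ} (hf : Continuous f) : Continuous (negConj f) := by
  unfold _root_.negConj
  fun_prop

theorem HasScrambledSet.of_negConj {f : ℝ → ℝ} (h : HasScrambledSet (negConj f)) :
    HasScrambledSet f := by
  obtain ⟨S, hS, h⟩ := h
  have hd : ∀ x y n, dist (f^[n] (-x)) (f^[n] (-y))
      = dist ((negConj f)^[n] x) ((negConj f)^[n] y) := fun x y n => by
    rw [negConj_iterate, negConj_iterate, dist_neg_neg]
  refine ⟨Neg.neg '' S, fun hc => hS ?_, ?_⟩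
  · exact Set.countable_of_injective_of_countable_image neg_injective.injOn hc
  · rintro _ ⟨x, hx, rfl⟩ _ ⟨y, hy, rfl⟩ hxy
    simp only [hd]
    exact h x hx y hy fun e => hxy (by rw [e])

/-- `z` is fixed by `g`, and some point strictly between `z` and a preimage `b` of `z` is mapped to
`b` or beyond it, as seen from `z`. -/
def IsTurbulent (g : ℝ → ℝ) : Prop :=
  ∃ z b c, g z = z ∧ g b = z ∧ ((z < c ∧ c < b ∧ b ≤ g c) ∨ (g c ≤ b ∧ b < c ∧ c < z))

theorem IsTurbulent.negConj_iterate {f : ℝ → ℝ} {p : ℕ} (h : IsTurbulent f^[p]) :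
    IsTurbulent (negConj f)^[p] := by
  obtain ⟨z, b, c, hz, hb, h⟩ := h
  refine ⟨-z, -b, -c, ?_⟩
  simp only [_root_.negConj_iterate, neg_neg, hz, hb, neg_lt_neg_iff, neg_le_neg_iff, true_and]
  tauto

theorem surjOn_of_le_of_le {g : ℝ → ℝ} (hg : Continuous g) {s : Set ℝ} [s.OrdConnected] {u v l r : ℝ}
    (hu : u ∈ s) (hv : v ∈ s) (hl : g u ≤ l) (hr : r ≤ g v) : Set.SurjOn g s (Set.Icc l r) := by
  intro w hw
  obtain ⟨y, hy, rfl⟩ := intermediate_value_uIcc hg.continuousOn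
    (Set.Icc_subset_uIcc ⟨hl.trans hw.1, hw.2.trans hr⟩)
  exact ⟨y, Set.OrdConnected.uIcc_subset ‹_› hu hv hy, rfl⟩

/-- Successive preimages `u k` of `c` near a fixed point and `v k` near a preimage of that point. -/
theorem exists_preimage_sequences {g : ℝ → ℝ} (hg : Continuous g) {z b c : ℝ} (hz : g z = z)
    (hb : g b = z) (hzc : z < c) (hcb : c < b) (hbc : b ≤ g c) :
    ∃ u v : ℕ → ℝ, u 0 = c ∧ Antitone u ∧ Monotone v ∧ (∀ k, z ≤ u k) ∧ c ≤ v 0 ∧ (∀ k, v k ≤ b) ∧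
      (∀ k, g (u (k + 1)) = u k) ∧ ∀ k, g (v k) = u k := by
  let P : ℝ × ℝ → Prop := fun p => (z ≤ p.1 ∧ p.1 ≤ g p.1) ∧ p.2 ≤ b ∧ g p.2 = p.1
  have hstep : ∀ p : {p : ℝ × ℝ // P p}, ∃ q : {p : ℝ × ℝ // P p},
      q.1.1 ≤ p.1.1 ∧ g q.1.1 = p.1.1 ∧ p.1.2 ≤ q.1.2 := by
    rintro ⟨⟨u, v⟩, ⟨hzu, hug⟩, hvb, hgv⟩
    simp only at hzu hug hvb hgv
    obtain ⟨u', hu', hgu'⟩ := surjOn_of_le_of_le hg (s := Set.Icc z u) (l := u) (r := u)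
      (Set.left_mem_Icc.2 hzu) (Set.right_mem_Icc.2 hzu) (by linarith) hug ⟨le_rfl, le_rfl⟩
    obtain ⟨v', hv', hgv'⟩ := surjOn_of_le_of_le hg (s := Set.Icc v b) (l := u') (r := u')
      (Set.right_mem_Icc.2 hvb) (Set.left_mem_Icc.2 hvb) (by linarith [hu'.1])
      (by linarith [hu'.2]) ⟨le_rfl, le_rfl⟩
    exact ⟨⟨(u', v'), ⟨hu'.1, by simp only; linarith [hu'.2]⟩, hv'.2, hgv'⟩, hu'.2, hgu', hv'.1⟩
  choose next h1 h2 h3 using hstep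
  obtain ⟨v₀, hv₀, hgv₀⟩ := surjOn_of_le_of_le hg (s := Set.Icc c b) (l := c) (r := c)
    (Set.right_mem_Icc.2 hcb.le) (Set.left_mem_Icc.2 hcb.le) (by linarith) (by linarith)
    ⟨le_rfl, le_rfl⟩
  let w : ℕ → {p : ℝ × ℝ // P p} := fun n => Nat.rec
    ⟨(c, v₀), ⟨hzc.le, hcb.le.trans hbc⟩, hv₀.2, hgv₀⟩ (fun _ p => next p) n
  exact ⟨fun k => (w k).1.1, fun k => (w k).1.2, rfl, antitone_nat_of_succ_le fun k => h1 (w k),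
    monotone_nat_of_le_succ fun k => h3 (w k), fun k => (w k).2.1.1, hv₀.1, fun k => (w k).2.2.1,
    fun k => h2 (w k), fun k => (w k).2.2.2⟩

theorem hasScrambledSet_of_fixed_lt {f : ℝ → ℝ} (hf : Continuous f) {p : ℕ} (hp : 1 ≤ p)
    {z b c : ℝ} (hz : f^[p] z = z) (hb : f^[p] b = z) (hzc : z < c) (hcb : c < b)
    (hbc : b ≤ f^[p] c) : HasScrambledSet f := by
  set g := f^[p] with hg
  have hgc : Continuous g := hf.iterate p
  obtain ⟨u, v, hu0, hu, hv, hzu, hcv, hvb, hgu, hgv⟩ :=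
    exists_preimage_sequences hgc hz hb hzc hcb hbc
  have hul := tendsto_atTop_ciInf hu ⟨z, Set.forall_mem_range.2 hzu⟩
  have hvl := tendsto_atTop_ciSup hv ⟨b, Set.forall_mem_range.2 hvb⟩
  set α := ⨅ k, u k
  set β := ⨆ k, v k
  have hαu : ∀ k, α ≤ u k := fun k => hu.le_of_tendsto hul k
  have hvβ : ∀ k, v k ≤ β := fun k => hv.ge_of_tendsto hvl k
  have hβb : β ≤ b := le_of_tendsto' hvl hvb
  have hgα : g α = α := tendsto_nhds_unique ((hgc.tendsto α).comp ((tendsto_add_atTop_iff_nat 1).2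
    hul)) (by simpa [Function.comp_def, hgu] using hul)
  have hgβ : g β = α := tendsto_nhds_unique ((hgc.tendsto β).comp hvl)
    (by simpa [Function.comp_def, hgv] using hul)
  have hαc : α < c := by
    refine lt_of_le_of_ne (hu0 ▸ hαu 0) fun h => ?_
    rw [h] at hgα
    linarith
  have hcβ : c ≤ β := hcv.trans (hvβ 0)
  have hgα' : ∀ k, g^[k] α = α := fun k => Function.iterate_fixed hgα k
  have hgu' : ∀ k, g^[k] (u k) = c := fun k => by
    induction k with
    | zero => simpa using hu0
    | succ k ih => rw [Function.iterate_succ_apply, hgu, ih]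
  let C : ℕ → Bool → Set ℝ := fun k i => cond i (Set.Icc α (u k)) (Set.Icc (v k) β)
  have hCsub : ∀ k i, C k i ⊆ Set.Icc α (g c) := by
    rintro k (_ | _)
    · exact Set.Icc_subset_Icc (by linarith [hv k.zero_le]) (by linarith)
    · exact Set.Icc_subset_Icc le_rfl (by linarith [hu k.zero_le])
  refine HasScrambledSet.of_surjOn hf (C := C) (γ := fun i => cond i α β)
    (by simp only [cond_true, cond_false]; linarith) ?_ ?_ ?_ (fun k => p * (k + 2))
    (fun k => by nlinarith) ?_
  · rintro k (_ | _) <;> exact isCompact_Icc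
  · rintro k (_ | _)
    · exact Set.nonempty_Icc.2 (hvβ k)
    · exact Set.nonempty_Icc.2 (hαu k)
  · intro ε hε
    filter_upwards [hul.eventually (Metric.ball_mem_nhds α hε),
      hvl.eventually (Metric.ball_mem_nhds β hε)] with k hk1 hk2
    rintro (_ | _)
    · exact (convex_ball _ _).ordConnected.out hk2 (Metric.mem_ball_self hε)
    · exact (convex_ball _ _).ordConnected.out (Metric.mem_ball_self hε) hk1
  · intro k i j
    rw [Function.iterate_mul]
    refine Set.SurjOn.mono subset_rfl (hCsub (k + 1) j) ?_
    cases i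
    · refine surjOn_of_le_of_le (s := Set.Icc (v k) β) (hgc.iterate _) (Set.right_mem_Icc.2 (hvβ k))
        (Set.left_mem_Icc.2 (hvβ k)) ?_ ?_
      · rw [Function.iterate_succ_apply, hgβ, hgα']
      · rw [Function.iterate_succ_apply, hgv, Function.iterate_succ_apply', hgu']
    · refine surjOn_of_le_of_le (s := Set.Icc α (u k)) (hgc.iterate _) (Set.left_mem_Icc.2 (hαu k))
        (v := u (k + 1)) ⟨hαu _, hu k.le_succ⟩ ?_ ?_
      · rw [hgα']
      · rw [Function.iterate_succ_apply', hgu']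

theorem IsTurbulent.hasScrambledSet {f : ℝ → ℝ} (hf : Continuous f) {p : ℕ} (hp : 1 ≤ p)
    (h : IsTurbulent f^[p]) : HasScrambledSet f := by
  obtain ⟨z, b, c, hz, hb, ⟨h1, h2, h3⟩ | ⟨h1, h2, h3⟩⟩ := h
  · exact hasScrambledSet_of_fixed_lt hf hp hz hb h1 h2 h3
  · exact (hasScrambledSet_of_fixed_lt (z := -z) (b := -b) (c := -c) hf.negConj hp
      (by simp [_root_.negConj_iterate, hz]) (by simp [_root_.negConj_iterate, hb])
      (neg_lt_neg h3) (neg_lt_neg h2)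
      (by simpa [_root_.negConj_iterate] using h1)).of_negConj

theorem negConj_negConj (f : ℝ → ℝ) : negConj (negConj f) = f := by
  ext x
  simp [negConj]

theorem iterate_apply_orbit {G : ℝ → ℝ} {o : ℕ → ℝ} (ho : ∀ k, o (k + 1) = G (o k)) (k p : ℕ) :
    G^[p] (o k) = o (k + p) := by
  induction p with
  | zero => rfl
  | succ p ih => rw [Function.iterate_succ_apply', ih, ← ho, add_assoc]

theorem exists_isTurbulent_of_lt_of_lt {G : ℝ → ℝ} (hG : Continuous G) {z : ℝ} (hz : G z = z)
    {o : ℕ → ℝ} (ho : ∀ k, o (k + 1) = G (o k)) (hinj : ∀ k, o (k + 1) ≠ o k) (hoz : ∀ k, o k ≠ z)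
    (hrec : ∀ k, ∀ s ∈ 𝓝 (o k), ∃ᶠ n in atTop, o n ∈ s) {k l : ℕ} (h1 : o k < z)
    (h2 : o (k + 1) < z) (h3 : z < o l) : ∃ p ≥ 1, IsTurbulent G^[p] := by
  classical
  have hex : ∃ n, k + 2 ≤ n ∧ z < o n :=
    frequently_atTop.1 (hrec l _ (Ioi_mem_nhds h3)) (k + 2)
  obtain ⟨hn1, hn2⟩ := Nat.find_spec hex
  have hmin : ∀ j, k ≤ j → j < Nat.find hex → o j < z := by
    intro j hj hjn
    rcases (show j = k ∨ j = k + 1 ∨ k + 2 ≤ j by omega) with rfl | rfl | h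
    · exact h1
    · exact h2
    · have := Nat.find_min hex hjn
      exact lt_of_le_of_ne (not_lt.1 fun h' => this ⟨h, h'⟩) (hoz j)
  obtain ⟨m, hm⟩ := Nat.exists_eq_add_of_le' (show 2 ≤ Nat.find hex by omega)
  have ha := hmin m (by omega) (by omega)
  have hb := hmin (m + 1) (by omega) (by omega)
  rw [hm] at hn2
  have ea : G (o m) = o (m + 1) := (ho m).symm
  have eb : G (o (m + 1)) = o (m + 2) := (ho (m + 1)).symm
  rcases (hinj m).symm.lt_or_gt with hlt | hlt
  · obtain ⟨w, ⟨hw1, hw2⟩, hGw⟩ := surjOn_of_le_of_le hG (s := Set.Icc (o m) (o (m + 1)))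
      (l := z) (r := z) (Set.left_mem_Icc.2 hlt.le) (Set.right_mem_Icc.2 hlt.le)
      (by rw [ea]; exact hb.le) (by rw [eb]; exact hn2.le) ⟨le_rfl, le_rfl⟩
    have hw1' : o m < w := lt_of_le_of_ne hw1 fun h => by rw [← h, ea] at hGw; linarith
    have hw2' : w < o (m + 1) := lt_of_le_of_ne hw2 fun h => by rw [h, eb] at hGw; linarith
    obtain ⟨K, hK, hKw⟩ := frequently_atTop.1 (hrec m _ (Iio_mem_nhds hw1')) (m + 2)
    obtain ⟨p, rfl⟩ := Nat.exists_eq_add_of_le hK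
    refine ⟨p + 1, by omega, z, w, o (m + 1), Function.iterate_fixed hz _, ?_, Or.inr ⟨?_, hw2', hb⟩⟩
    · rw [Function.iterate_succ_apply, hGw, Function.iterate_fixed hz]
    · rw [iterate_apply_orbit ho, show m + 1 + (p + 1) = m + 2 + p by ring]
      exact (Set.mem_Iio.1 hKw).le
  · obtain ⟨w, ⟨hw1, hw2⟩, hGw⟩ := surjOn_of_le_of_le hG (s := Set.Icc (o (m + 1)) (o m))
      (l := z) (r := z) (Set.right_mem_Icc.2 hlt.le) (Set.left_mem_Icc.2 hlt.le)
      (by rw [ea]; exact hb.le) (by rw [eb]; exact hn2.le) ⟨le_rfl, le_rfl⟩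
    have hw2' : w < o m := lt_of_le_of_ne hw2 fun h => by rw [h, ea] at hGw; linarith
    refine ⟨1, le_rfl, z, w, o m, ?_, ?_, Or.inr ⟨?_, hw2', ha⟩⟩
    · simpa using hz
    · simpa using hGw
    · simpa [ea] using hw1

/-- A recurrent non-periodic orbit of a map none of whose iterates is turbulent visits the two sides
of some fixed point alternately. -/
theorem exists_alternating {G : ℝ → ℝ} (hG : Continuous G) (hT : ∀ p ≥ 1, ¬ IsTurbulent G^[p])
    {o : ℕ → ℝ} (ho : ∀ k, o (k + 1) = G (o k)) (hinj : ∀ k, o (k + 1) ≠ o k)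
    (hrec : ∀ k, ∀ s ∈ 𝓝 (o k), ∃ᶠ n in atTop, o n ∈ s) :
    ∃ z, ∀ k, (o k < z ∧ z < o (k + 1)) ∨ (z < o k ∧ o (k + 1) < z) := by
  have hup : ∃ u, o u < o (u + 1) := by
    by_contra! h
    have ha : Antitone o := antitone_nat_of_succ_le h
    have h01 : o 1 < o 0 := lt_of_le_of_ne (h 0) (hinj 0)
    obtain ⟨n, hn, hn'⟩ := frequently_atTop.1 (hrec 0 _ (Ioi_mem_nhds h01)) 1
    exact absurd (ha hn) (not_le.2 hn')
  have hdn : ∃ d, o (d + 1) < o d := by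
    by_contra! h
    have ha : Monotone o := monotone_nat_of_le_succ h
    have h01 : o 0 < o 1 := lt_of_le_of_ne (h 0) (hinj 0).symm
    obtain ⟨n, hn, hn'⟩ := frequently_atTop.1 (hrec 0 _ (Iio_mem_nhds h01)) 1
    exact absurd (ha hn) (not_le.2 hn')
  obtain ⟨u, hu⟩ := hup
  obtain ⟨d, hd⟩ := hdn
  obtain ⟨z, hzm, hz⟩ : ∃ z ∈ Set.uIcc (o d) (o u), G z - z = 0 :=
    surjOn_of_le_of_le (g := fun x => G x - x) (hG.sub continuous_id) (s := Set.uIcc (o d) (o u))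
      (l := 0) (r := 0) Set.left_mem_uIcc Set.right_mem_uIcc (by rw [← ho]; linarith)
      (by rw [← ho]; linarith) ⟨le_rfl, le_rfl⟩
  have hz : G z = z := by linarith
  have hoz : ∀ k, o k ≠ z := fun k h => hinj k (by rw [ho, h, hz])
  have hsides : (∃ l, o l < z) ∧ ∃ l, z < o l := by
    rcases Set.mem_uIcc.1 hzm with ⟨h1, h2⟩ | ⟨h1, h2⟩
    · exact ⟨⟨d, lt_of_le_of_ne h1 (hoz d)⟩, u, lt_of_le_of_ne h2 (hoz u).symm⟩
    · exact ⟨⟨u, lt_of_le_of_ne h1 (hoz u)⟩, d, lt_of_le_of_ne h2 (hoz d).symm⟩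
  obtain ⟨⟨a, ha⟩, b, hb⟩ := hsides
  refine ⟨z, fun k => ?_⟩
  rcases (hoz k).lt_or_gt with h | h
  · refine Or.inl ⟨h, ?_⟩
    by_contra h'
    obtain ⟨p, hp, hp'⟩ := exists_isTurbulent_of_lt_of_lt hG hz ho hinj hoz hrec h
      (lt_of_le_of_ne (not_lt.1 h') (hoz _)) hb
    exact hT p hp hp'
  · refine Or.inr ⟨h, ?_⟩
    by_contra h'
    obtain ⟨p, hp, hp'⟩ := exists_isTurbulent_of_lt_of_lt (G := negConj G) (z := -z)
      (o := fun k => -o k) (k := k) (l := a) hG.negConj (by simp [negConj, hz])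
      (by simp [negConj, ho]) (by simpa using hinj) (by simpa using hoz)
      (fun j s hs => by
        have := hrec j (Neg.neg ⁻¹' s) (continuous_neg.continuousAt.preimage_mem_nhds hs)
        simpa using this)
      (neg_lt_neg h) (neg_lt_neg (lt_of_le_of_ne (not_lt.1 h') (hoz _).symm)) (neg_lt_neg ha)
    exact hT p hp (by simpa [negConj_negConj] using hp'.negConj_iterate)

theorem modEq_add_iff_of_dvd {N t j e : ℕ} (h : N ∣ t) : j + t ≡ e [MOD N] ↔ j ≡ e [MOD N] := by
  obtain ⟨c, rfl⟩ := h
  simp [Nat.ModEq]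

theorem modEq_or_modEq_add {n i j : ℕ} (h : j ≡ i [MOD 2 ^ n]) :
    j ≡ i [MOD 2 ^ (n + 1)] ∨ j ≡ i + 2 ^ n [MOD 2 ^ (n + 1)] := by
  obtain ⟨c, hc⟩ := Nat.modEq_iff_dvd.1 h
  rcases Int.even_or_odd' c with ⟨d, rfl | rfl⟩
  · exact Or.inl (Nat.modEq_iff_dvd.2 ⟨d, by push_cast at hc ⊢; rw [hc]; ring⟩)
  · refine Or.inr (Nat.modEq_iff_dvd.2 ⟨d + 1, ?_⟩)
    push_cast at hc ⊢
    linear_combination hc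

/-- The residue class of `idx n` modulo `2 ^ n`. -/
def branch (idx : ℕ → ℕ) (n : ℕ) : Set ℕ := {j | j ≡ idx n [MOD 2 ^ n]}

/-- The other half of the class containing `branch idx (n + 1)`. -/
def cobranch (idx : ℕ → ℕ) (n : ℕ) : Set ℕ := {j | j ≡ idx (n + 1) + 2 ^ n [MOD 2 ^ (n + 1)]}

theorem branch_antitone {idx : ℕ → ℕ} (hidx : ∀ n, idx (n + 1) ≡ idx n [MOD 2 ^ n]) :
    Antitone (branch idx) :=
  antitone_nat_of_succ_le fun n j (hj : j ≡ _ [MOD _]) =>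
    (hj.of_dvd (pow_dvd_pow 2 n.le_succ)).trans (hidx n)

theorem mem_branch_succ_or_mem_cobranch {idx : ℕ → ℕ} (hidx : ∀ n, idx (n + 1) ≡ idx n [MOD 2 ^ n])
    {n j : ℕ} (hj : j ∈ branch idx n) :
    j ∈ branch idx (n + 1) ∨ j ∈ cobranch idx n :=
  modEq_or_modEq_add (Nat.ModEq.trans hj (hidx n).symm)

theorem cobranch_subset_branch {idx : ℕ → ℕ} (hidx : ∀ n, idx (n + 1) ≡ idx n [MOD 2 ^ n])
    (n : ℕ) : cobranch idx n ⊆ branch idx n :=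
  fun j (hj : j ≡ _ [MOD _]) => by
    have h := (hj.of_dvd (pow_dvd_pow 2 n.le_succ)).trans
      ((modEq_add_iff_of_dvd dvd_rfl).2 (hidx n))
    exact h

theorem add_mem_cobranch {idx : ℕ → ℕ} {n m j : ℕ} (h : n < m) (hj : j ∈ cobranch idx n) :
    j + 2 ^ m ∈ cobranch idx n :=
  (modEq_add_iff_of_dvd (pow_dvd_pow 2 h)).2 hj

theorem add_mem_cobranch_of_mem_branch {idx : ℕ → ℕ} {m j : ℕ} (hj : j ∈ branch idx (m + 1)) :
    j + 2 ^ m ∈ cobranch idx m :=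
  Nat.ModEq.add_right _ hj

theorem exists_add_mem {idx : ℕ → ℕ} {m j : ℕ} (hj : j ∈ branch idx (m + 1)) (hm : 2 ^ m ≤ j) :
    ∃ i ∈ cobranch idx m, i + 2 ^ m = j := by
  obtain ⟨i, rfl⟩ := Nat.exists_eq_add_of_le' hm
  refine ⟨i, ?_, rfl⟩
  have h := Nat.ModEq.add_right (2 ^ m) hj
  rw [add_assoc, ← two_mul, ← pow_succ'] at h
  exact (modEq_add_iff_of_dvd dvd_rfl).1 h

theorem exists_mem_cobranch (idx : ℕ → ℕ) (n : ℕ) : ∃ j ∈ cobranch idx n, 2 ^ n ≤ j :=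
  ⟨_, Nat.ModEq.refl _, Nat.le_add_left _ _⟩

/-- An orbit returning to `Iio β` along each class modulo `2 ^ n` cannot have all the sets
`cobranch idx n` eventually outside `Iio β`. -/
theorem not_forall_cobranch_le {idx : ℕ → ℕ} (hidx : ∀ n, idx (n + 1) ≡ idx n [MOD 2 ^ n])
    {o : ℕ → ℝ} {β : ℝ} {n₀ : ℕ}
    (hrec : ∀ j, ∀ s ∈ 𝓝 (o j), ∃ᶠ k in atTop, o (j + 2 ^ n₀ * k) ∈ s)
    (hle : ∀ n ≥ n₀, ∀ j ∈ cobranch idx n, β ≤ o j) : ∀ j ∈ branch idx n₀, β ≤ o j := by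
  by_contra! ⟨j, hj, hjβ⟩
  have key : ∀ i ∈ branch idx n₀, o i < β → ∀ n, i ∈ branch idx n := by
    intro i hi hiβ n
    rcases le_total n n₀ with h | h
    · exact branch_antitone hidx h hi
    · induction n, h using Nat.le_induction with
      | base => exact hi
      | succ n hn ih =>
        exact (mem_branch_succ_or_mem_cobranch hidx ih).resolve_right
          fun h => not_le.2 hiβ (hle n hn i h)
  obtain ⟨k, hk, hkβ⟩ := frequently_atTop.1 (hrec j _ (Iio_mem_nhds hjβ)) 1
  have h1 := key j hj hjβ (n₀ + k)
  have h2 := key _ ((modEq_add_iff_of_dvd (dvd_mul_right _ _)).2 hj) hkβ (n₀ + k)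
  have h3 : 2 ^ (n₀ + k) ∣ 2 ^ n₀ * k :=
    (Nat.modEq_zero_iff_dvd.1 (Nat.ModEq.add_left_cancel' j (h2.trans h1.symm)))
  rw [pow_add] at h3
  have h4 := Nat.le_of_dvd (by omega) (Nat.dvd_of_mul_dvd_mul_left (by positivity) h3)
  exact absurd h4 (not_le.2 k.lt_two_pow_self)

/-- Nested residue classes modulo powers of two on which `o` oscillates by `ε`. -/
theorem exists_branch {o : ℕ → ℝ} {ε : ℝ}
    (h : ∀ n, ∃ j j', j ≡ j' [MOD 2 ^ n] ∧ ε ≤ |o j - o j'|) :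
    ∃ idx : ℕ → ℕ, (∀ n, idx (n + 1) ≡ idx n [MOD 2 ^ n]) ∧
      ∀ n, ∃ j ∈ branch idx n, ∃ j' ∈ branch idx n, ε ≤ |o j - o j'| := by
  let wide : ℕ → ℕ → Prop := fun n i =>
    ∃ j j', j ≡ i [MOD 2 ^ n] ∧ j' ≡ i [MOD 2 ^ n] ∧ ε ≤ |o j - o j'|
  have hwide : ∀ {m n i i'}, m ≤ n → i ≡ i' [MOD 2 ^ m] → wide n i → wide m i' := by
    rintro m n i i' hmn hi ⟨j, j', h1, h2, h3⟩
    exact ⟨j, j', (h1.of_dvd (pow_dvd_pow 2 hmn)).trans hi,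
      (h2.of_dvd (pow_dvd_pow 2 hmn)).trans hi, h3⟩
  let good : ℕ → ℕ → Prop := fun n i => ∀ N ≥ n, ∃ i', i' ≡ i [MOD 2 ^ n] ∧ wide N i'
  have hstep : ∀ n i, ∃ i', i' ≡ i [MOD 2 ^ n] ∧ (good n i → good (n + 1) i') := by
    intro n i
    by_cases h1 : good (n + 1) i
    · exact ⟨i, rfl, fun _ => h1⟩
    refine ⟨i + 2 ^ n, by simp, fun hg N hN => ?_⟩
    simp only [good, not_forall] at h1
    obtain ⟨N₁, hN₁, h1⟩ := h1
    obtain ⟨i', hi', hw⟩ := hg (max N N₁) (by omega)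
    rcases modEq_or_modEq_add hi' with h | h
    · exact absurd ⟨i', h, hwide (le_max_right _ _) rfl hw⟩ h1
    · exact ⟨i', h, hwide (le_max_left _ _) rfl hw⟩
  choose next h1 h2 using hstep
  let idx : ℕ → ℕ := fun n => Nat.rec 0 next n
  have hgood : ∀ n, good n (idx n) := by
    intro n
    induction n with
    | zero =>
      intro N _
      obtain ⟨j, j', hj, hε⟩ := h N
      exact ⟨j', by simp [Nat.modEq_one], j, j', hj, rfl, hε⟩
    | succ n ih => exact h2 n _ ih
  refine ⟨idx, fun n => h1 n _, fun n => ?_⟩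
  obtain ⟨i', hi', hw⟩ := hgood n n le_rfl
  obtain ⟨j, j', hj, hj', hε⟩ := hwide le_rfl hi' hw
  exact ⟨j, hj, j', hj', hε⟩

theorem frequently_iterate_add_mem {Y : Type*} [TopologicalSpace Y] {F : Y → Y} (hF : Continuous F)
    {x : Y} {m : ℕ} (hrec : ∀ s ∈ 𝓝 x, ∃ᶠ n in atTop, (F^[m])^[n] x ∈ s) (j : ℕ) :
    ∀ s ∈ 𝓝 (F^[j] x), ∃ᶠ n in atTop, F^[j + m * n] x ∈ s := by
  intro s hs
  refine (hrec _ ((hF.iterate j).continuousAt.preimage_mem_nhds hs)).mono fun n hn => ?_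
  rwa [Set.mem_preimage, ← Function.iterate_mul, ← Function.iterate_add_apply] at hn

theorem iterate_ne_iterate {F : ℝ → ℝ} (hF : Continuous F) {x : ℝ}
    (hrec : ∀ m ≥ 1, ∀ s ∈ 𝓝 x, ∃ᶠ n in atTop, (F^[m])^[n] x ∈ s)
    (hper : ∀ m ≥ 1, F^[m] x ≠ x) {i p : ℕ} (hp : 1 ≤ p) : F^[i + p] x ≠ F^[i] x := by
  intro h
  have hopen : IsOpen {y | F^[p] y ≠ y} := isOpen_ne_fun (hF.iterate p) continuous_id
  obtain ⟨n, hn, hn'⟩ := frequently_atTop.1 (hrec p hp _ (hopen.mem_nhds (hper p hp))) i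
  refine hn' ?_
  obtain ⟨t, ht⟩ := Nat.exists_eq_add_of_le' (hn.trans (Nat.le_mul_of_pos_left n hp))
  rw [← Function.iterate_mul, ← Function.iterate_add_apply, ht, show p + (t + i) = t + (i + p) by
    ring, Function.iterate_add_apply, h, ← Function.iterate_add_apply]

theorem lt_iff_lt_of_alternating {o : ℕ → ℝ} {z : ℝ}
    (h : ∀ k, (o k < z ∧ z < o (k + 1)) ∨ (z < o k ∧ o (k + 1) < z)) (k : ℕ) :
    o k < z ↔ (o 0 < z ↔ Even k) := by
  induction k with
  | zero => simp
  | succ k ih =>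
    rw [Nat.even_add_one]
    rcases h k with ⟨h1, h2⟩ | ⟨h1, h2⟩
    · have := h2.not_gt
      tauto
    · have := h1.not_gt
      tauto

/-- The two classes modulo `2 ^ (n + 1)` in a class modulo `2 ^ n` are separated by a point. -/
theorem exists_separation {F : ℝ → ℝ} (hF : Continuous F) (hT : ∀ p ≥ 1, ¬ IsTurbulent F^[p]) {x : ℝ}
    (hrec : ∀ m ≥ 1, ∀ s ∈ 𝓝 x, ∃ᶠ n in atTop, (F^[m])^[n] x ∈ s)
    (hper : ∀ m ≥ 1, F^[m] x ≠ x) (n i : ℕ) :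
    (∀ j j', j ≡ i + 2 ^ n [MOD 2 ^ (n + 1)] → j' ≡ i [MOD 2 ^ (n + 1)] → F^[j] x ≤ F^[j'] x) ∨
    (∀ j j', j ≡ i + 2 ^ n [MOD 2 ^ (n + 1)] → j' ≡ i [MOD 2 ^ (n + 1)] → F^[j'] x ≤ F^[j] x) := by
  set r := i % 2 ^ n
  let o : ℕ → ℝ := fun k => F^[r + 2 ^ n * k] x
  have hpow : 1 ≤ 2 ^ n := Nat.one_le_two_pow
  obtain ⟨z, hz⟩ := exists_alternating (G := F^[2 ^ n]) (hF.iterate _)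
    (fun p hp => by
      rw [← Function.iterate_mul]
      exact hT _ (Nat.mul_pos hpow hp))
    (o := o) (fun k => by
      simp only [o]
      rw [← Function.iterate_add_apply, show r + 2 ^ n * (k + 1) = 2 ^ n + (r + 2 ^ n * k) by ring])
    (fun k => by
      have := iterate_ne_iterate hF hrec hper (i := r + 2 ^ n * k) hpow
      simpa only [o, mul_add, mul_one, add_assoc] using this)
    (fun k s hs => by
      have h := frequently_iterate_add_mem hF (hrec _ hpow) _ s hs
      rw [frequently_atTop] at h ⊢
      intro N
      obtain ⟨b, hb, hbs⟩ := h N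
      refine ⟨k + b, by omega, ?_⟩
      simpa only [o, mul_add, add_assoc] using hbs)
  have hside := lt_iff_lt_of_alternating hz
  have hor : ∀ k, ¬ o k < z → z ≤ o k := fun k => not_lt.1
  have hdecomp : ∀ j, j % 2 ^ n = r → F^[j] x = o (j / 2 ^ n) := fun j hj => by
    simp only [o]
    rw [← hj, Nat.mod_add_div]
  have hmod : ∀ j c, j ≡ i + 2 ^ n * c [MOD 2 ^ (n + 1)] →
      j % 2 ^ n = r ∧ (Even (j / 2 ^ n) ↔ (Even (i / 2 ^ n) ↔ Even c)) := by
    intro j c hj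
    have h1 : j ≡ i [MOD 2 ^ n] :=
      (hj.of_dvd (pow_dvd_pow 2 n.le_succ)).trans (by simp [Nat.ModEq])
    refine ⟨h1, ?_⟩
    have e1 := Nat.mod_add_div j (2 ^ n)
    have e2 := Nat.mod_add_div i (2 ^ n)
    rw [show j % 2 ^ n = i % 2 ^ n from h1] at e1
    have h2 : i % 2 ^ n + 2 ^ n * (j / 2 ^ n) ≡ i % 2 ^ n + 2 ^ n * (i / 2 ^ n + c)
        [MOD 2 ^ n * 2] := by
      rwa [e1, mul_add, ← add_assoc, e2, ← pow_succ]
    replace h2 : j / 2 ^ n ≡ i / 2 ^ n + c [MOD 2] :=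
      Nat.ModEq.mul_left_cancel' (by positivity) (Nat.ModEq.add_left_cancel' _ h2)
    rw [← Nat.even_add, Nat.even_iff, Nat.even_iff, h2]
  by_cases h0 : o (i / 2 ^ n) < z
  · right
    intro j j' hj hj'
    obtain ⟨a1, a2⟩ := hmod j 1 (by simpa using hj)
    obtain ⟨b1, b2⟩ := hmod j' 0 (by simpa using hj')
    rw [hdecomp j a1, hdecomp j' b1]
    have c1 := hside (j / 2 ^ n)
    have c2 := hside (j' / 2 ^ n)
    rw [hside] at h0
    simp only [Nat.not_even_one, iff_false, Even.zero, iff_true] at a2 b2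
    have d1 : o (j' / 2 ^ n) < z := by tauto
    have d2 : ¬ o (j / 2 ^ n) < z := by tauto
    exact d1.le.trans (hor _ d2)
  · left
    intro j j' hj hj'
    obtain ⟨a1, a2⟩ := hmod j 1 (by simpa using hj)
    obtain ⟨b1, b2⟩ := hmod j' 0 (by simpa using hj')
    rw [hdecomp j a1, hdecomp j' b1]
    have c1 := hside (j / 2 ^ n)
    have c2 := hside (j' / 2 ^ n)
    rw [hside] at h0
    simp only [Nat.not_even_one, iff_false, Even.zero, iff_true] at a2 b2
    have d1 : ¬ o (j' / 2 ^ n) < z := by tauto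
    have d2 : o (j / 2 ^ n) < z := by tauto
    exact d2.le.trans (hor _ d1)

/-- If the oscillation along the classes `branch idx n` does not tend to zero, the gap left in the
limit gives a scrambled set. -/
theorem hasScrambledSet_of_branch {F : ℝ → ℝ} (hF : Continuous F) {x : ℝ}
    (hrec : ∀ m ≥ 1, ∀ j, ∀ s ∈ 𝓝 (F^[j] x), ∃ᶠ k in atTop, F^[j + m * k] x ∈ s)
    (hbdd : Bornology.IsBounded (Set.range fun j => F^[j] x))
    {idx : ℕ → ℕ} (hidx : ∀ n, idx (n + 1) ≡ idx n [MOD 2 ^ n])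
    (hsep : ∀ n, (∀ j ∈ cobranch idx n, ∀ j' ∈ branch idx (n + 1), F^[j] x ≤ F^[j'] x) ∨
      ∀ j ∈ cobranch idx n, ∀ j' ∈ branch idx (n + 1), F^[j'] x ≤ F^[j] x)
    {ε : ℝ} (hε : 0 < ε)
    (hosc : ∀ n, ∃ j ∈ branch idx n, ∃ j' ∈ branch idx n, ε ≤ |F^[j] x - F^[j'] x|) :
    HasScrambledSet F := by
  set o : ℕ → ℝ := fun j => F^[j] x with ho
  have hoadd : ∀ j p, F^[p] (o j) = o (j + p) := fun j p => by
    simp only [ho]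
    rw [← Function.iterate_add_apply, add_comm]
  let a : ℕ → ℝ := fun n => sInf (o '' branch idx n)
  let b : ℕ → ℝ := fun n => sSup (o '' branch idx n)
  have hbelow : ∀ n, BddBelow (o '' branch idx n) := fun n =>
    hbdd.bddBelow.mono (Set.image_subset_range _ _)
  have habove : ∀ n, BddAbove (o '' branch idx n) := fun n =>
    hbdd.bddAbove.mono (Set.image_subset_range _ _)
  have hbr : ∀ n, (branch idx n).Nonempty := fun n => ⟨idx n, Nat.ModEq.refl _⟩
  have hne : ∀ n, (o '' branch idx n).Nonempty := fun n => (hbr n).image _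
  have hao : ∀ n, ∀ j ∈ branch idx n, a n ≤ o j := fun n j hj =>
    csInf_le (hbelow n) ⟨j, hj, rfl⟩
  have hob : ∀ n, ∀ j ∈ branch idx n, o j ≤ b n := fun n j hj =>
    le_csSup (habove n) ⟨j, hj, rfl⟩
  have ha : Monotone a := fun m n h =>
    csInf_le_csInf (hbelow m) (hne n) (Set.image_mono (branch_antitone hidx h))
  have hb : Antitone b := fun m n h =>
    csSup_le_csSup (habove m) (hne n) (Set.image_mono (branch_antitone hidx h))
  have hab : ∀ n, a n + ε ≤ b n := fun n => by
    obtain ⟨j, hj, j', hj', h⟩ := hosc n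
    have h1 := hao n j hj
    have h2 := hao n j' hj'
    have h3 := hob n j hj
    have h4 := hob n j' hj'
    rcases le_abs'.1 h with h | h <;> linarith
  have hab' : ∀ m n, a m + ε ≤ b n := fun m n =>
    (add_le_add_left (ha (le_max_left m n)) ε).trans
      ((hab (max m n)).trans (hb (le_max_right m n)))
  have hal := tendsto_atTop_ciSup ha ⟨b 0, Set.forall_mem_range.2 fun n => by linarith [hab' n 0]⟩
  have hbl := tendsto_atTop_ciInf hb ⟨a 0, Set.forall_mem_range.2 fun n => by linarith [hab' 0 n]⟩
  set α := ⨆ n, a n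
  set β := ⨅ n, b n
  have haα : ∀ n, a n ≤ α := fun n => ha.ge_of_tendsto hal n
  have hβb : ∀ n, β ≤ b n := fun n => hb.le_of_tendsto hbl n
  have hαβ : α + ε ≤ β :=
    ge_of_tendsto' hbl fun n => le_of_tendsto' (hal.add_const ε) fun m => hab' m n
  have hleft : ∀ N, ∃ n ≥ N, ∀ j ∈ cobranch idx n, o j ≤ a (n + 1) := by
    by_contra! ⟨N, hN⟩
    have h1 := not_forall_cobranch_le hidx (o := o) (β := β) (n₀ := N)
      (hrec _ Nat.one_le_two_pow) fun n hn j hj => by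
        obtain ⟨i, hi, hlt⟩ := hN n hn
        rcases hsep n with h | h
        · refine absurd (le_csInf (hne (n + 1)) ?_) (not_le.2 hlt)
          rintro _ ⟨j', hj', rfl⟩
          exact h i hi j' hj'
        · refine (hβb (n + 1)).trans (csSup_le (hne (n + 1)) ?_)
          rintro _ ⟨j', hj', rfl⟩
          exact h j hj j' hj'
    have h2 : β ≤ a N := le_csInf (hne N) (Set.forall_mem_image.2 h1)
    linarith [haα N]
  have hright : ∀ N, ∃ n ≥ N, ∀ j ∈ cobranch idx n, b (n + 1) ≤ o j := by
    by_contra! ⟨N, hN⟩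
    have h1 := not_forall_cobranch_le hidx (o := fun j => -o j) (β := -α) (n₀ := N)
      (fun j s hs => by
        have := hrec (2 ^ N) Nat.one_le_two_pow j (Neg.neg ⁻¹' s)
          (continuous_neg.continuousAt.preimage_mem_nhds hs)
        simpa using this)
      fun n hn j hj => by
        obtain ⟨i, hi, hlt⟩ := hN n hn
        rcases hsep n with h | h
        · refine neg_le_neg (le_trans (le_csInf (hne (n + 1)) ?_) (haα (n + 1)))
          rintro _ ⟨j', hj', rfl⟩
          exact h j hj j' hj'
        · refine absurd (csSup_le (hne (n + 1)) ?_) (not_le.2 hlt)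
          rintro _ ⟨j', hj', rfl⟩
          exact h i hi j' hj'
    have h2 : b N ≤ α :=
      csSup_le (hne N) (Set.forall_mem_image.2 fun j hj => neg_le_neg_iff.1 (h1 j hj))
    linarith [hβb N]
  choose nl hnl hl using hleft
  choose nr hnr hr using hright
  let n : ℕ → ℕ := fun k => Nat.rec (nl 0) (fun _ p => nl (nl (nr (p + 1) + 1) + 1)) k
  let m : ℕ → ℕ := fun k => nr (n k + 1)
  let q : ℕ → ℕ := fun k => nl (m k + 1)
  have hn1 : ∀ k, n (k + 1) = nl (q k + 1) := fun k => rfl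
  have hnm : ∀ k, n k < m k := fun k => hnr (n k + 1)
  have hmq : ∀ k, m k < q k := fun k => hnl (m k + 1)
  have hqn : ∀ k, q k < n (k + 1) := fun k => hnl (q k + 1)
  have hln : ∀ k, ∀ j ∈ cobranch idx (n k), o j ≤ a (n k + 1) := by
    rintro (_ | k)
    · exact hl 0
    · exact hl (q k + 1)
  have hlq : ∀ k, ∀ j ∈ cobranch idx (q k), o j ≤ a (q k + 1) := fun k => hl (m k + 1)
  have hrm : ∀ k, ∀ j ∈ cobranch idx (m k), b (m k + 1) ≤ o j := fun k => hr (n k + 1)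
  have hmn : ∀ k, m k < n (k + 1) := fun k => (hmq k).trans (hqn k)
  have hnmono : StrictMono n := strictMono_nat_of_lt_succ fun k => lt_trans (hnm k) (hmn k)
  have hmmono : StrictMono m := strictMono_nat_of_lt_succ fun k => lt_trans (hmn k) (hnm (k + 1))
  let C : ℕ → Bool → Set ℝ := fun k i => cond i (Set.Icc (a (n k)) α) (Set.Icc β (b (m k)))
  have hCsub : ∀ k i, C k i ⊆ Set.Icc (a (n k)) (b (m k)) := by
    rintro k (_ | _)
    · exact Set.Icc_subset_Icc (by linarith [haα (n k)]) le_rfl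
    · exact Set.Icc_subset_Icc le_rfl (by linarith [hβb (m k)])
  refine HasScrambledSet.of_surjOn hF (C := C) (γ := fun i => cond i α β)
    (by simp only [cond_true, cond_false]; linarith) ?_ ?_ ?_ (fun k => 2 ^ m k)
    (fun k => Nat.one_le_two_pow) ?_
  · rintro k (_ | _) <;> exact isCompact_Icc
  · rintro k (_ | _)
    · exact Set.nonempty_Icc.2 (hβb _)
    · exact Set.nonempty_Icc.2 (haα _)
  · intro δ hδ
    filter_upwards [(hal.comp hnmono.tendsto_atTop).eventually (Metric.ball_mem_nhds α hδ),
      (hbl.comp hmmono.tendsto_atTop).eventually (Metric.ball_mem_nhds β hδ)] with k hk1 hk2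
    rintro (_ | _)
    · exact (convex_ball _ _).ordConnected.out (Metric.mem_ball_self hδ) hk2
    · exact (convex_ball _ _).ordConnected.out hk1 (Metric.mem_ball_self hδ)
  · intro k i j
    refine Set.SurjOn.mono subset_rfl (hCsub (k + 1) j) ?_
    have hqn' : a (q k + 1) ≤ a (n (k + 1)) := ha (hqn k)
    have hmm' : b (m (k + 1)) ≤ b (m k + 1) := hb (hmmono k.lt_succ_self)
    have hsub := cobranch_subset_branch hidx
    have hanti := branch_antitone hidx
    cases i
    · obtain ⟨r, hrq, hr2⟩ := exists_mem_cobranch idx (q k)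
      obtain ⟨u, hu, rfl⟩ := exists_add_mem (m := m k) (hanti (hmq k) (hsub _ hrq))
        ((Nat.pow_le_pow_right two_pos (hmq k).le).trans hr2)
      obtain ⟨v, hv, -⟩ := exists_mem_cobranch idx (m (k + 1))
      refine surjOn_of_le_of_le (s := Set.Icc β (b (m k))) (hF.iterate _) (u := o u) (v := o v)
        ⟨(hβb _).trans (hrm k u hu), hob _ _ (hsub _ hu)⟩
        ⟨(hβb _).trans (hrm (k + 1) v hv), hob _ _ (hanti (hmmono k.lt_succ_self).le (hsub _ hv))⟩
        ?_ ?_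
      · rw [hoadd]
        exact (hlq k _ hrq).trans hqn'
      · rw [hoadd]
        exact hmm'.trans (hrm k _ (add_mem_cobranch_of_mem_branch
          (hanti (hmmono k.lt_succ_self) (hsub _ hv))))
    · obtain ⟨u, hu, -⟩ := exists_mem_cobranch idx (n k)
      obtain ⟨v, hv, -⟩ := exists_mem_cobranch idx (q k)
      refine surjOn_of_le_of_le (s := Set.Icc (a (n k)) α) (hF.iterate _) (u := o u) (v := o v)
        ⟨hao _ _ (hsub _ hu), (hln k u hu).trans (haα _)⟩
        ⟨hao _ _ (hanti ((hnm k).trans (hmq k)).le (hsub _ hv)), (hlq k v hv).trans (haα _)⟩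
        ?_ ?_
      · rw [hoadd]
        exact (hln k _ (add_mem_cobranch (hnm k) hu)).trans (ha ((hnm k).trans (hmn k)))
      · rw [hoadd]
        exact hmm'.trans (hrm k _ (add_mem_cobranch_of_mem_branch (hanti (hmq k) (hsub _ hv))))

/-- Without scrambled sets, a bounded orbit recurrent under all iterates is regularly recurrent,
uniformly along the orbit. -/
theorem exists_period_of_not_hasScrambledSet {F : ℝ → ℝ} (hF : Continuous F)
    (hS : ¬ HasScrambledSet F) {x : ℝ}
    (hrec : ∀ m ≥ 1, ∀ s ∈ 𝓝 x, ∃ᶠ n in atTop, (F^[m])^[n] x ∈ s)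
    (hbdd : Bornology.IsBounded (Set.range fun j => F^[j] x)) {ε : ℝ} (hε : 0 < ε) :
    ∃ m ≥ 1, ∀ i k, |F^[i + m * k] x - F^[i] x| < ε := by
  by_cases hper : ∀ m ≥ 1, F^[m] x ≠ x
  · have hT : ∀ p ≥ 1, ¬ IsTurbulent F^[p] := fun p hp h => hS (h.hasScrambledSet hF hp)
    by_contra! h
    obtain ⟨idx, hidx, hosc⟩ := exists_branch (o := fun j => F^[j] x) (ε := ε) fun n => by
      obtain ⟨i, k, hik⟩ := h (2 ^ n) Nat.one_le_two_pow
      exact ⟨_, i, by simp [Nat.ModEq], hik⟩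
    exact hS (hasScrambledSet_of_branch hF
      (fun m hm j => frequently_iterate_add_mem hF (hrec m hm) j) hbdd hidx
      (fun n => (exists_separation hF hT hrec hper n (idx (n + 1))).imp
        (fun h j hj j' hj' => h j j' hj hj') fun h j hj j' hj' => h j j' hj hj') hε hosc)
  · push Not at hper
    obtain ⟨m, hm, hx⟩ := hper
    refine ⟨m, hm, fun i k => ?_⟩
    rw [Function.iterate_add_apply, Function.iterate_mul, Function.iterate_fixed hx]
    simpa using hε

/-- A continuous map taking the values `l ≤ r` on an interval maps a subinterval exactly onto
`[l, r]`, endpoints to endpoints. -/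
theorem exists_uIcc_mapsTo {g : ℝ → ℝ} (hg : Continuous g) {l r u v : ℝ} (hlr : l ≤ r)
    (hu : g u = l) (hv : g v = r) :
    ∃ u' ∈ Set.uIcc u v, ∃ v' ∈ Set.uIcc u v, g u' = l ∧ g v' = r ∧
      Set.MapsTo g (Set.uIcc u' v') (Set.Icc l r) := by
  wlog huv : u ≤ v generalizing g l r u v
  · obtain ⟨u', hu', v', hv', h1, h2, h3⟩ := this (g := fun y => -g y) hg.neg (neg_le_neg hlr)
      (neg_inj.2 hv) (neg_inj.2 hu) (le_of_not_ge huv)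
    rw [Set.uIcc_comm v u] at hu' hv'
    refine ⟨v', hv', u', hu', neg_inj.1 h2, neg_inj.1 h1, fun y hy => ?_⟩
    rw [Set.uIcc_comm] at hy
    obtain ⟨h4, h5⟩ := h3 hy
    exact ⟨neg_le_neg_iff.1 h5, neg_le_neg_iff.1 h4⟩
  obtain ⟨v', ⟨⟨huv', hv'v⟩, hgv⟩, hmin⟩ :=
    (isCompact_Icc.inter_right (isClosed_singleton.preimage hg)).exists_isLeast
      (⟨v, ⟨huv, le_rfl⟩, hv⟩ : (Set.Icc u v ∩ g ⁻¹' {r}).Nonempty)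
  obtain ⟨u', ⟨⟨huu', hu'v'⟩, hgu⟩, hmax⟩ :=
    (isCompact_Icc.inter_right (isClosed_singleton.preimage hg)).exists_isGreatest
      (⟨u, ⟨le_rfl, huv'⟩, hu⟩ : (Set.Icc u v' ∩ g ⁻¹' {l}).Nonempty)
  rw [Set.mem_preimage, Set.mem_singleton_iff] at hgv hgu
  rw [Set.uIcc_of_le huv]
  refine ⟨u', ⟨huu', hu'v'.trans hv'v⟩, v', ⟨huv', hv'v⟩, hgu, hgv, fun y hy => ?_⟩
  rw [Set.uIcc_of_le hu'v'] at hy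
  refine ⟨not_lt.1 fun hlt => ?_, not_lt.1 fun hlt => ?_⟩
  · obtain ⟨t, ht, hgt⟩ := intermediate_value_Icc hy.2 hg.continuousOn
      (⟨hlt.le, hgv ▸ hlr⟩ : l ∈ Set.Icc (g y) (g v'))
    have h1 := hmax ⟨⟨huu'.trans (hy.1.trans ht.1), ht.2⟩, hgt⟩
    have h2 : t = y := le_antisymm (h1.trans hy.1) ht.1
    rw [← h2, hgt] at hlt
    exact lt_irrefl _ hlt
  · obtain ⟨t, ht, hgt⟩ := intermediate_value_Icc hy.1 hg.continuousOn
      (⟨hgu ▸ hlr, hlt.le⟩ : r ∈ Set.Icc (g u') (g y))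
    have h1 := hmin ⟨⟨huu'.trans ht.1, ht.2.trans (hy.2.trans hv'v)⟩, hgt⟩
    have h2 : t = y := le_antisymm ht.2 (hy.2.trans h1)
    rw [← h2, hgt] at hlt
    exact lt_irrefl _ hlt

/-- A loop of intervals, each covering the next, is followed by a periodic point. -/
theorem exists_iterate_eq_of_covering {F : ℝ → ℝ} (hF : Continuous F) {l r : ℕ → ℝ}
    (hlr : ∀ i, l i ≤ r i)
    (hcov : ∀ i, Set.Icc (l (i + 1)) (r (i + 1)) ⊆ F '' Set.Icc (l i) (r i)) {m : ℕ}
    (hm : Set.Icc (l 0) (r 0) ⊆ Set.Icc (l m) (r m)) :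
    ∃ y, F^[m] y = y ∧ ∀ i ≤ m, F^[i] y ∈ Set.Icc (l i) (r i) := by
  have key : ∀ n, ∃ u v, F^[n] u = l n ∧ F^[n] v = r n ∧
      ∀ y ∈ Set.uIcc u v, ∀ i ≤ n, F^[i] y ∈ Set.Icc (l i) (r i) := by
    intro n
    induction n with
    | zero =>
      refine ⟨l 0, r 0, rfl, rfl, fun y hy i hi => ?_⟩
      rw [Set.uIcc_of_le (hlr 0)] at hy
      obtain rfl := Nat.le_zero.1 hi
      exact hy
    | succ n ih =>
      obtain ⟨u, v, hu, hv, h⟩ := ih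
      have hit : ∀ t ∈ Set.Icc (l (n + 1)) (r (n + 1)), ∃ s ∈ Set.uIcc u v, F^[n + 1] s = t := by
        intro t ht
        obtain ⟨t', ht', rfl⟩ := hcov n ht
        rw [← Set.uIcc_of_le (hlr n), ← hu, ← hv] at ht'
        obtain ⟨s, hs, rfl⟩ := intermediate_value_uIcc (hF.iterate n).continuousOn ht'
        exact ⟨s, hs, Function.iterate_succ_apply' _ _ _⟩
      obtain ⟨s, hs, hsl⟩ := hit _ ⟨le_rfl, hlr (n + 1)⟩
      obtain ⟨t, ht, htr⟩ := hit _ ⟨hlr (n + 1), le_rfl⟩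
      obtain ⟨u', hu', v', hv', h1, h2, h3⟩ :=
        exists_uIcc_mapsTo (hF.iterate (n + 1)) (hlr (n + 1)) hsl htr
      refine ⟨u', v', h1, h2, fun y hy i hi => ?_⟩
      rcases hi.lt_or_eq with hi | rfl
      · exact h y (Set.uIcc_subset_uIcc hs ht (Set.uIcc_subset_uIcc hu' hv' hy)) i (by omega)
      · exact h3 hy
  obtain ⟨u, v, hu, hv, h⟩ := key m
  have hu0 := (hm (h u Set.left_mem_uIcc 0 m.zero_le)).1
  have hv0 := (hm (h v Set.right_mem_uIcc 0 m.zero_le)).2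
  simp only [Function.iterate_zero, id_eq] at hu0 hv0
  obtain ⟨y, hy, hy0⟩ := intermediate_value_uIcc (f := fun y => F^[m] y - y) (a := u) (b := v)
    ((hF.iterate m).sub continuous_id).continuousOn
    (Set.mem_uIcc.2 (Or.inl ⟨by linarith, by linarith⟩) : (0 : ℝ) ∈ _)
  exact ⟨y, sub_eq_zero.1 hy0, h y hy⟩

/-- A bounded orbit, recurrent under `F^[m]` and almost periodic with almost period `m`, is followed
by a periodic point. -/
theorem exists_iterate_eq_of_period {F : ℝ → ℝ} (hF : Continuous F) {x : ℝ} {m : ℕ}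
    (hm : 1 ≤ m) (hrec : ∀ s ∈ 𝓝 x, ∃ᶠ n in atTop, (F^[m])^[n] x ∈ s)
    (hbdd : Bornology.IsBounded (Set.range fun j => F^[j] x)) {ε : ℝ}
    (hε : ∀ i k, |F^[i + m * k] x - F^[i] x| < ε) :
    ∃ y, F^[m] y = y ∧ ∀ i, |F^[i] y - F^[i] x| < 2 * ε := by
  let O : ℕ → Set ℝ := fun i => Set.range fun k => F^[i + m * k] x
  have hsub : ∀ i, O i ⊆ Set.range fun j => F^[j] x := by
    rintro i _ ⟨k, rfl⟩
    exact ⟨_, rfl⟩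
  have hlb : ∀ i, BddBelow (O i) := fun i => hbdd.bddBelow.mono (hsub i)
  have hub : ∀ i, BddAbove (O i) := fun i => hbdd.bddAbove.mono (hsub i)
  have hne : ∀ i, (O i).Nonempty := fun i => Set.range_nonempty _
  have hO : ∀ i, O i ⊆ Set.Icc (sInf (O i)) (sSup (O i)) := fun i y hy =>
    ⟨csInf_le (hlb i) hy, le_csSup (hub i) hy⟩
  have hlr : ∀ i, sInf (O i) ≤ sSup (O i) := fun i => (hO i (hne i).some_mem).1.trans (hO i (hne i).some_mem).2
  have hcl : ∀ i, closure (O i) ⊆ Set.Icc (sInf (O i)) (sSup (O i)) := fun i =>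
    closure_minimal (hO i) isClosed_Icc
  obtain ⟨y, hy, hyI⟩ := exists_iterate_eq_of_covering hF (l := fun i => sInf (O i))
    (r := fun i => sSup (O i)) (m := m) hlr (fun i => by
      have hcomp := (isCompact_Icc (a := sInf (O i)) (b := sSup (O i))).image hF
      have hconn := (isPreconnected_Icc (a := sInf (O i)) (b := sSup (O i))).image F
        hF.continuousOn
      have hO' : closure (O (i + 1)) ⊆ F '' Set.Icc (sInf (O i)) (sSup (O i)) := by
        refine closure_minimal ?_ hcomp.isClosed
        rintro _ ⟨k, rfl⟩
        refine ⟨_, hO i ⟨k, rfl⟩, ?_⟩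
        simp only [← Function.iterate_succ_apply' F]
        rw [show (i + m * k).succ = i + 1 + m * k by omega]
      exact hconn.ordConnected.out (hO' (csInf_mem_closure (hne _) (hlb _)))
        (hO' (csSup_mem_closure (hne _) (hub _)))) (by
      have hO' : O 0 ⊆ closure (O m) := by
        rintro _ ⟨_ | k, rfl⟩
        · simp only [mul_zero, add_zero]
          refine mem_closure_iff_nhds.2 fun s hs => ?_
          obtain ⟨n, hn, hns⟩ := frequently_atTop.1 (hrec s hs) 1
          obtain ⟨n, rfl⟩ := Nat.exists_eq_add_of_le hn
          refine ⟨_, hns, n, ?_⟩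
          simp only
          rw [← Function.iterate_mul, mul_add, mul_one]
        · refine subset_closure ⟨k, ?_⟩
          simp only
          rw [show 0 + m * (k + 1) = m + m * k by ring]
      have h0 := hO'.trans (hcl m)
      exact Set.Icc_subset_Icc (le_csInf (hne 0) fun z hz => (h0 hz).1)
        (csSup_le (hne 0) fun z hz => (h0 hz).2))
  have hclose : ∀ i ≤ m, |F^[i] y - F^[i] x| ≤ ε := by
    intro i hi
    obtain ⟨h1, h2⟩ := hyI i hi
    have h3 : F^[i] x - ε ≤ sInf (O i) := le_csInf (hne i) (by
      rintro _ ⟨k, rfl⟩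
      have := (abs_lt.1 (hε i k)).1
      simp only
      linarith)
    have h4 : sSup (O i) ≤ F^[i] x + ε := csSup_le (hne i) (by
      rintro _ ⟨k, rfl⟩
      have := (abs_lt.1 (hε i k)).2
      simp only
      linarith)
    exact abs_le.2 ⟨by linarith, by linarith⟩
  refine ⟨y, hy, fun i => ?_⟩
  have h1 := hclose (i % m) (Nat.mod_lt i hm).le
  have h2 := hε (i % m) (i / m)
  rw [Nat.mod_add_div] at h2
  have h3 : F^[i] y = F^[i % m] y := by
    conv_lhs => rw [← Nat.mod_add_div i m, Function.iterate_add_apply, Function.iterate_mul,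
      Function.iterate_fixed hy]
  rw [h3]
  rw [abs_sub_comm] at h2
  linarith [abs_sub_le (F^[i % m] y) (F^[i % m] x) (F^[i] x)]

/-- The averages of a bounded, uniformly almost periodic sequence are close to the average over one
almost period. -/
theorem abs_sum_range_sub_le {c : ℕ → ℝ} {C ε : ℝ} {m : ℕ} (hm : 1 ≤ m) (hC : ∀ i, |c i| ≤ C)
    (hε : ∀ i k, |c (i + m * k) - c i| ≤ ε) (n : ℕ) :
    |∑ i ∈ Finset.range n, c i - n * ((∑ i ∈ Finset.range m, c i) / m)| ≤ n * ε + 2 * m * C := by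
  have hm0 : (0 : ℝ) < m := by exact_mod_cast hm
  have hC0 : 0 ≤ C := (abs_nonneg _).trans (hC 0)
  have hε0 : 0 ≤ ε := (abs_nonneg _).trans (hε 0 0)
  have hsum : ∀ s (d : ℕ → ℝ) (D : ℝ), (∀ i, |d i| ≤ D) →
      |∑ i ∈ Finset.range s, d i| ≤ s * D := fun s d D hD =>
    (Finset.abs_sum_le_sum_abs _ _).trans
      ((Finset.sum_le_sum fun i _ => hD i).trans (by simp))
  set A := (∑ i ∈ Finset.range m, c i) / m with hA
  have hmA : ∑ i ∈ Finset.range m, c i = m * A := by rw [hA]; field_simp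
  have hAC : |A| ≤ C := by
    rw [hA, abs_div, Nat.abs_cast, div_le_iff₀ hm0, mul_comm]
    exact hsum m c C hC
  have hblock : ∀ q : ℕ, |∑ i ∈ Finset.range (m * q), c i - q * (m * A)| ≤ q * (m * ε) := by
    intro q
    induction q with
    | zero => simp
    | succ q ih =>
      have h := hsum m (fun i => c (i + m * q) - c i) ε fun i => hε i q
      rw [Finset.sum_sub_distrib, hmA] at h
      rw [mul_add, mul_one, Finset.sum_range_add]
      simp only [add_comm (m * q)]
      push_cast
      calc _ = |(∑ i ∈ Finset.range (m * q), c i - q * (m * A)) +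
            (∑ i ∈ Finset.range m, c (i + m * q) - m * A)| := by congr 1; ring
        _ ≤ _ := (abs_add_le _ _).trans (by linarith)
  have hn := Nat.div_add_mod n m
  set q := n / m
  set s := n % m
  have hs : (s : ℝ) ≤ m := by exact_mod_cast (Nat.mod_lt n hm).le
  have h1 := hblock q
  have h2 := hsum s (fun i => c (m * q + i)) C fun i => hC _
  have h3 : |(s : ℝ) * A| ≤ m * C := by
    rw [abs_mul, Nat.abs_cast]
    gcongr
  have h4 : (s : ℝ) * C ≤ m * C := by gcongr
  have h5 : (0 : ℝ) ≤ s * ε := by positivity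
  rw [← hn, Finset.sum_range_add]
  push_cast
  rw [abs_le] at h1 h2 h3 ⊢
  constructor <;> linarith [h1.1, h1.2, h2.1, h2.2, h3.1, h3.2]

/-- Averages of bounded, uniformly almost periodic sequences converge. -/
theorem exists_tendsto_average {c : ℕ → ℝ} {C : ℝ} (hC : ∀ i, |c i| ≤ C)
    (h : ∀ ε > 0, ∃ m ≥ 1, ∀ i k, |c (i + m * k) - c i| ≤ ε) :
    ∃ L, Tendsto (fun n : ℕ => (n : ℝ)⁻¹ * ∑ i ∈ Finset.range n, c i) atTop (𝓝 L) := by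
  refine cauchySeq_tendsto_of_complete (Metric.cauchySeq_iff'.2 fun ε hε => ?_)
  obtain ⟨m, hm, hper⟩ := h (ε / 4) (by positivity)
  have hlim : Tendsto (fun n : ℕ => ε / 4 + 2 * m * C / n) atTop (𝓝 (ε / 4 + 0)) :=
    (tendsto_const_div_atTop_nhds_zero_nat _).const_add _
  obtain ⟨N, hN⟩ := eventually_atTop.1
    ((hlim.eventually (gt_mem_nhds (by linarith : ε / 4 + 0 < ε / 2))).and (eventually_gt_atTop 0))
  set A := (∑ i ∈ Finset.range m, c i) / m
  have hclose : ∀ n ≥ N, dist ((n : ℝ)⁻¹ * ∑ i ∈ Finset.range n, c i) A < ε / 2 := by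
    intro n hn
    obtain ⟨h1, h2⟩ := hN n hn
    have hn0 : (0 : ℝ) < n := by exact_mod_cast h2
    refine lt_of_le_of_lt ?_ h1
    have h3 := abs_sum_range_sub_le hm hC hper n
    rw [Real.dist_eq]
    calc _ = |∑ i ∈ Finset.range n, c i - n * A| / n := by
          rw [← Nat.abs_cast n, ← abs_div, Nat.abs_cast]
          congr 1
          field_simp
      _ ≤ (n * (ε / 4) + 2 * m * C) / n := by gcongr
      _ = _ := by field_simp
  refine ⟨N, fun n hn => ?_⟩
  linarith [dist_triangle_right ((n : ℝ)⁻¹ * ∑ i ∈ Finset.range n, c i)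
    ((N : ℝ)⁻¹ * ∑ i ∈ Finset.range N, c i) A, hclose n hn, hclose N le_rfl]

/-- If the Birkhoff averages of a bounded observable converge almost everywhere, the limit is the
space average. -/
theorem ae_tendsto_birkhoffAverage_integral {X : Type*} [MeasurableSpace X] {μ : Measure X}
    [IsProbabilityMeasure μ] {f : X → X} (hf : Ergodic f μ) {g : X → ℝ} (hg : Measurable g) {C : ℝ}
    (hC : ∀ x, |g x| ≤ C)
    (h : ∀ᵐ x ∂μ, ∃ L, Tendsto (fun n => birkhoffAverage ℝ f g n x) atTop (𝓝 L)) :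
    ∀ᵐ x ∂μ, Tendsto (fun n => birkhoffAverage ℝ f g n x) atTop (𝓝 (∫ x, g x ∂μ)) := by
  have hmeas : ∀ n, Measurable (birkhoffAverage ℝ f g n) := fun n =>
    (Finset.measurable_sum (Finset.range n) fun i _ =>
      hg.comp (hf.measurable.iterate i)).const_smul (n : ℝ)⁻¹
  have hbd : ∀ n x, |birkhoffAverage ℝ f g n x| ≤ C := by
    intro n x
    rcases n.eq_zero_or_pos with rfl | hn
    · simpa using (abs_nonneg _).trans (hC x)
    have hn0 : (0 : ℝ) < n := by exact_mod_cast hn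
    rw [birkhoffAverage, smul_eq_mul, abs_mul, abs_inv, Nat.abs_cast, inv_mul_le_iff₀ hn0]
    exact (Finset.abs_sum_le_sum_abs _ _).trans
      ((Finset.sum_le_sum fun i _ => hC _).trans (by simp))
  have hint : ∀ n ≥ 1, ∫ x, birkhoffAverage ℝ f g n x ∂μ = ∫ x, g x ∂μ := by
    intro n hn
    have hgi : ∀ i, Integrable (fun x => g (f^[i] x)) μ := fun i =>
      Integrable.of_bound (hg.comp (hf.measurable.iterate i)).aestronglyMeasurable C
        (ae_of_all _ fun x => hC _)
    have hi : ∀ i, ∫ x, g (f^[i] x) ∂μ = ∫ x, g x ∂μ := fun i => by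
      have hi := hf.toMeasurePreserving.iterate i
      conv_rhs => rw [← hi.map_eq]
      exact (integral_map hi.aemeasurable hg.aestronglyMeasurable).symm
    simp only [birkhoffAverage, birkhoffSum]
    rw [integral_smul, integral_finsetSum _ fun i _ => hgi i, Finset.sum_congr rfl fun i _ => hi i,
      Finset.sum_const, Finset.card_range, nsmul_eq_mul, smul_eq_mul,
      inv_mul_cancel_left₀ (by positivity)]
  obtain ⟨G, hG, hlim⟩ := measurable_limit_of_tendsto_metrizable_ae
    (fun n => (hmeas n).aemeasurable) h
  have hinv : G ∘ f =ᵐ[μ] G := by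
    filter_upwards [hlim, hf.quasiMeasurePreserving.ae hlim] with x h1 h2
    have h3 := tendsto_birkhoffAverage_apply_sub_birkhoffAverage' ℝ (g := g)
      (isBounded_iff_forall_norm_le.2 ⟨C, Set.forall_mem_range.2 hC⟩) f x
    exact sub_eq_zero.1 (tendsto_nhds_unique (h2.sub h1) h3)
  obtain ⟨c, hc⟩ := hf.ae_eq_const_of_ae_eq_comp₀ hG.nullMeasurable hinv
  have hlim' : ∀ᵐ x ∂μ, Tendsto (fun n => birkhoffAverage ℝ f g n x) atTop (𝓝 c) := by
    filter_upwards [hlim, hc] with x h1 h2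
    rwa [h2] at h1
  have h1 := tendsto_integral_of_dominated_convergence (fun _ => C)
    (fun n => (hmeas n).aestronglyMeasurable) (integrable_const C)
    (fun n => ae_of_all _ fun x => hbd n x) hlim'
  have h2 : ∫ x, g x ∂μ = c := by
    refine tendsto_nhds_unique (tendsto_const_nhds.congr' ?_) (h1.trans (by simp))
    filter_upwards [eventually_ge_atTop 1] with n hn
    exact (hint n hn).symm
  rwa [h2]

/-- On a compact space, weak convergence of probability measures may be tested on a dense set of
continuous functions. -/
theorem tendsto_of_dense {X : Type*} [TopologicalSpace X] [CompactSpace X] [MeasurableSpace X]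
    [OpensMeasurableSpace X] {ν : ℕ → ProbabilityMeasure X} {μ : ProbabilityMeasure X}
    {D : Set C(X, ℝ)} (hD : Dense D)
    (h : ∀ φ ∈ D, Tendsto (fun n => ∫ x, φ x ∂(ν n : Measure X)) atTop
      (𝓝 (∫ x, φ x ∂(μ : Measure X)))) : Tendsto ν atTop (𝓝 μ) := by
  have hlip : ∀ ρ : ProbabilityMeasure X,
      LipschitzWith 1 fun φ : C(X, ℝ) => ∫ x, φ x ∂(ρ : Measure X) := by
    intro ρ
    have hint : ∀ φ : C(X, ℝ), Integrable φ (ρ : Measure X) := fun φ =>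
      (BoundedContinuousFunction.mkOfCompact φ).integrable _
    refine LipschitzWith.of_dist_le_mul fun φ ψ => ?_
    rw [Real.dist_eq, ← integral_sub (hint φ) (hint ψ), NNReal.coe_one, one_mul]
    have := norm_integral_le_of_norm_le_const (μ := (ρ : Measure X)) (f := fun x => φ x - ψ x)
      (ae_of_all _ fun x => ContinuousMap.dist_apply_le_dist (f := φ) (g := ψ) x)
    simpa using this
  have hclosed := (LipschitzWith.uniformEquicontinuous
    (fun n (φ : C(X, ℝ)) => ∫ x, φ x ∂(ν n : Measure X)) 1
    fun n => hlip (ν n)).equicontinuous.isClosed_setOfPred_tendsto (l := atTop) (hlip μ).continuous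
  refine ProbabilityMeasure.tendsto_iff_forall_integral_tendsto.2 fun φ => ?_
  exact hclosed.closure_subset_iff.2 h (hD φ.toContinuousMap)

theorem integral_avgDirac_s8 {X : Type*} [MetricSpace X] [MeasurableSpace X] [BorelSpace X]
    {f : X → X} {x : X} {g : X → ℝ} {n : ℕ} (hn : 1 ≤ n) :
    ∫ y, g y ∂(avgDirac (fun i => f^[i] x) n : Measure X) = birkhoffAverage ℝ f g n x := by
  simp only [avgDirac, ProbabilityMeasure.coe_mk]
  rw [integral_smul_measure, integral_finsetSum_measure fun i _ =>
    integrable_dirac (by simp), max_eq_left hn]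
  simp [birkhoffAverage, birkhoffSum]

/-- If almost every orbit is uniformly almost periodic, almost every point is generic. -/
theorem ae_genericFor {X : Type*} [MetricSpace X] [CompactSpace X] [MeasurableSpace X]
    [BorelSpace X] {f : X → X} {μ : ProbabilityMeasure X} (hf : Ergodic f (μ : Measure X))
    (h : ∀ᵐ x ∂(μ : Measure X), ∀ ε > 0, ∃ m ≥ 1, ∀ i k, dist (f^[i + m * k] x) (f^[i] x) < ε) :
    ∀ᵐ x ∂(μ : Measure X), genericFor f x μ := by
  obtain ⟨D, hDc, hD⟩ := TopologicalSpace.exists_countable_dense C(X, ℝ)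
  have hφ : ∀ φ ∈ D, ∀ᵐ x ∂(μ : Measure X), Tendsto (fun n => birkhoffAverage ℝ f φ n x) atTop
      (𝓝 (∫ x, φ x ∂(μ : Measure X))) := by
    intro φ _
    refine ae_tendsto_birkhoffAverage_integral hf φ.continuous.measurable φ.norm_coe_le_norm ?_
    filter_upwards [h] with x hx
    refine exists_tendsto_average (fun i => φ.norm_coe_le_norm (f^[i] x)) fun ε hε => ?_
    obtain ⟨δ, hδ, hφδ⟩ := Metric.uniformContinuous_iff.1
      (CompactSpace.uniformContinuous_of_continuous φ.continuous) ε hε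
    obtain ⟨m, hm, hper⟩ := hx δ hδ
    exact ⟨m, hm, fun i k => (hφδ (hper i k)).le⟩
  filter_upwards [(ae_ball_iff hDc).2 hφ] with x hx
  refine tendsto_of_dense hD fun φ hφD => (hx φ hφD).congr' ?_
  filter_upwards [eventually_ge_atTop 1] with n hn
  exact (integral_avgDirac_s8 hn).symm

/-- Almost every point of an ergodic measure of a non-chaotic interval map is uniformly almost
periodic, and followed by periodic points. -/
theorem ae_exists_period {f : Set.Icc (0 : ℝ) 1 → Set.Icc (0 : ℝ) 1} (hf : Continuous f)
    (hS : ¬ HasScrambledSet f) {μ : Measure (Set.Icc (0 : ℝ) 1)} [IsFiniteMeasure μ]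
    (hμ : MeasurePreserving f μ μ) :
    ∀ᵐ x ∂μ, ∀ ε > 0, ∃ m ≥ 1, (∀ i k, dist (f^[i + m * k] x) (f^[i] x) < ε) ∧
      ∃ y, f^[m] y = y ∧ ∀ i, dist (f^[i] y) (f^[i] x) < ε := by
  set F : ℝ → ℝ := Set.IccExtend zero_le_one fun x => (f x : ℝ)
  have hF : Continuous F := (continuous_subtype_val.comp hf).Icc_extend'
  have hSF : ¬ HasScrambledSet F := fun h => hS (HasScrambledSet.of_iccExtend h)
  have hiter : ∀ n (x : Set.Icc (0 : ℝ) 1), F^[n] x = f^[n] x := fun n x =>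
    ((Function.Semiconj.iterate_right (f := Subtype.val) (ga := f) (gb := F)
      (fun x => (Set.IccExtend_val zero_le_one (fun x => (f x : ℝ)) x).symm) n) x).symm
  have hrec : ∀ᵐ x ∂μ, ∀ m : ℕ, ∀ s ∈ 𝓝 x, ∃ᶠ n in atTop, (f^[m])^[n] x ∈ s :=
    ae_all_iff.2 fun m => (hμ.iterate m).conservative.ae_frequently_mem_of_mem_nhds
  filter_upwards [hrec] with x hx
  have hxF : ∀ m ≥ 1, ∀ s ∈ 𝓝 (x : ℝ), ∃ᶠ n in atTop, (F^[m])^[n] x ∈ s := by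
    intro m _ s hs
    refine (hx m _ (continuous_subtype_val.continuousAt.preimage_mem_nhds hs)).mono fun n hn => ?_
    rw [← Function.iterate_mul, hiter, Function.iterate_mul]
    exact hn
  have hbdd : Bornology.IsBounded (Set.range fun j => F^[j] (x : ℝ)) :=
    (Metric.isBounded_Icc (0 : ℝ) 1).subset (Set.range_subset_iff.2 fun j => by
      rw [hiter]
      exact Subtype.coe_prop _)
  intro ε hε
  obtain ⟨m, hm, hper⟩ := exists_period_of_not_hasScrambledSet hF hSF hxF hbdd (half_pos hε)
  obtain ⟨y, hy, hclose⟩ := exists_iterate_eq_of_period hF hm (hxF m hm) hbdd hper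
  have hyI : y ∈ Set.Icc (0 : ℝ) 1 := by
    obtain ⟨p, rfl⟩ := Nat.exists_eq_add_of_le' hm
    rw [← hy, Function.iterate_succ_apply']
    exact Subtype.coe_prop _
  lift y to Set.Icc (0 : ℝ) 1 using hyI
  refine ⟨m, hm, fun i k => ?_, y, Subtype.ext ((hiter m y).symm.trans hy), fun i => ?_⟩
  · have := hper i k
    rw [hiter, hiter] at this
    rw [Subtype.dist_eq, Real.dist_eq]
    linarith
  · have := hclose i
    rwa [hiter, hiter, mul_div_cancel₀ _ two_ne_zero, ← Real.dist_eq, ← Subtype.dist_eq] at this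

theorem stmt8 (f : Set.Icc (0 : ℝ) 1 → Set.Icc (0 : ℝ) 1) (hf : Continuous f)
    (hly : ¬ LiYorkeChaotic f) :
    ∀ μ : ProbabilityMeasure (Set.Icc (0 : ℝ) 1), Ergodic f μ.toMeasure →
      ∃ x, genericFor f x μ ∧ ClosableAt f {y | ∃ p, 0 < p ∧ f^[p] y = y} x := by
  intro μ hμ
  have hS : ¬ HasScrambledSet f := fun h => hly (LiYorkeChaotic.of_hasScrambledSet h)
  have hper := ae_exists_period hf hS hμ.toMeasurePreserving
  have hgen := ae_genericFor hμ (hper.mono fun x hx ε hε =>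
    (hx ε hε).imp fun m hm => ⟨hm.1, hm.2.1⟩)
  obtain ⟨x, hx, hgx⟩ := (hper.and hgen).exists
  refine ⟨x, hgx, fun ε hε N => ?_⟩
  obtain ⟨m, hm, -, y, hy, hclose⟩ := hx ε hε
  have hN : N + 1 ≤ m * (N + 1) := Nat.le_mul_of_pos_left _ hm
  refine ⟨m * (N + 1), m * (N + 1), by omega, by omega, le_rfl, ?_, y, ⟨m, hm, hy⟩, ?_,
    fun i _ => hclose i⟩
  · exact le_mul_of_one_le_left (Nat.cast_nonneg _) (by linarith)
  · rw [Function.iterate_mul, Function.iterate_fixed hy]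
end

section
/- Let (X,T) be a Polish dynamical system, A ⊂ Per(T), B ⊂ Q_T(X). Then {μ_x : x ∈ A} is dense in the closed convex hull of {μ_y : y ∈ B} if and only if for every ε > 0, k ≥ 1, y_1,...,y_k ∈ B, and N ∈ ℕ there exist x ∈ A and n ≥ N with T^{kn} x = x and min_{σ∈S_{kn}} (1/(kn)) Σ_{i=0}^{kn−1} d(z_i, T^{σ(i)} x) < ε, where z_{i+(j−1)n} = T^i y_j for 0 ≤ i ≤ n−1, 1 ≤ j ≤ k. -/
open MeasureTheory Filter Topology
open scoped ENNReal NNReal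

/-! ### Convex hulls and uniform averages -/

section UniformAverages

variable {E : Type*} [AddCommMonoid E] [Module ℝ≥0 E]

/-- The set of uniform averages of nonempty finite families of points of `S`. -/
def uniformAverages (S : Set E) : Set E :=
  {m | ∃ k : ℕ, 0 < k ∧ ∃ v : Fin k → E, (∀ j, v j ∈ S) ∧ m = (k : ℝ≥0)⁻¹ • ∑ j, v j}

lemma average_mem_uniformAverages {S : Set E} {ι : Type*} [Fintype ι] [Nonempty ι] {v : ι → E}
    (hv : ∀ i, v i ∈ S) : (Fintype.card ι : ℝ≥0)⁻¹ • ∑ i, v i ∈ uniformAverages S := by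
  refine ⟨Fintype.card ι, Fintype.card_pos, v ∘ (Fintype.equivFin ι).symm, fun j => hv _, ?_⟩
  congr 1
  exact (Equiv.sum_comp (Fintype.equivFin ι).symm v).symm

lemma subset_uniformAverages (S : Set E) : S ⊆ uniformAverages S :=
  fun x hx => ⟨1, one_pos, fun _ => x, fun _ => hx, by simp⟩

lemma natCast_smul_add_mem_uniformAverages {S : Set E} {a b : E} (ha : a ∈ uniformAverages S)
    (hb : b ∈ uniformAverages S) {p r : ℕ} (h : 0 < p + r) :
    ((p : ℝ≥0) / (p + r : ℕ)) • a + ((r : ℝ≥0) / (p + r : ℕ)) • b ∈ uniformAverages S := by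
  obtain ⟨k, hk, u, hu, rfl⟩ := ha
  obtain ⟨l, hl, v, hv, rfl⟩ := hb
  have : Nonempty ((Fin p × (Fin k × Fin l)) ⊕ (Fin r × (Fin k × Fin l))) := by
    rw [← Fintype.card_pos_iff]
    simp only [Fintype.card_sum, Fintype.card_prod, Fintype.card_fin, ← add_mul]
    positivity
  have key := average_mem_uniformAverages (S := S)
    (v := Sum.elim (fun q : Fin p × (Fin k × Fin l) => u q.2.1)
      (fun q : Fin r × (Fin k × Fin l) => v q.2.2)) (by rintro (q | q) <;> simp [hu, hv])
  convert key using 1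
  have hk' : (k : ℝ≥0) ≠ 0 := by positivity
  have hl' : (l : ℝ≥0) ≠ 0 := by positivity
  have hpr : ((p + r : ℕ) : ℝ≥0) ≠ 0 := by positivity
  simp only [Fintype.sum_sum_type, Sum.elim_inl, Sum.elim_inr, Fintype.sum_prod_type,
    Finset.sum_const, Finset.card_univ, Fintype.card_fin, Fintype.card_sum, Fintype.card_prod,
    ← Finset.smul_sum, ← Nat.cast_smul_eq_nsmul ℝ≥0, smul_add, smul_smul]
  push_cast at hpr ⊢
  congr 2 <;> field_simp

lemma convex_closure_uniformAverages [TopologicalSpace E] [ContinuousAdd E] [ContinuousSMul ℝ≥0 E]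
    (S : Set E) : Convex ℝ≥0 (closure (uniformAverages S)) := by
  intro a ha b hb s t _ _ hst
  suffices h : ∀ a ∈ uniformAverages S, ∀ b ∈ uniformAverages S,
      s • a + t • b ∈ closure (uniformAverages S) by
    have := map_mem_closure₂ (f := fun a b : E => s • a + t • b) (by fun_prop) ha hb h
    rwa [closure_closure] at this
  intro a ha b hb
  have hfloor (c : ℝ≥0) : Tendsto (fun n : ℕ => (⌊c * n⌋₊ : ℝ≥0) / n) atTop (𝓝 c) := by
    rw [← NNReal.tendsto_coe]
    have := (tendsto_nat_floor_mul_div_atTop c.coe_nonneg).comp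
      (tendsto_natCast_atTop_atTop (R := ℝ))
    refine this.congr fun n => ?_
    have h : ⌊(c : ℝ) * n⌋₊ = ⌊c * n⌋₊ := Nonneg.nat_floor_coe (c * (n : ℝ≥0))
    simp [h]
  have hw (c d : ℝ≥0) (hcd : c + d = 1) :
      Tendsto (fun n : ℕ => (⌊c * n⌋₊ : ℝ≥0) / (⌊c * n⌋₊ + ⌊d * n⌋₊ : ℕ)) atTop (𝓝 c) := by
    have := (hfloor c).div ((hfloor c).add (hfloor d)) (by simp [hcd])
    rw [hcd, div_one] at this
    refine this.congr' ?_
    filter_upwards [eventually_gt_atTop 0] with n hn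
    have : (n : ℝ≥0) ≠ 0 := by positivity
    push_cast
    rw [Pi.div_apply, ← add_div, div_div_div_cancel_right₀ this]
  have hpos : ∀ᶠ n : ℕ in atTop, 0 < ⌊s * n⌋₊ + ⌊t * n⌋₊ := by
    have := ((hfloor s).add (hfloor t)).eventually_ne (hst ▸ one_ne_zero)
    filter_upwards [this] with n hn
    by_contra! h
    simp only [nonpos_iff_eq_zero, add_eq_zero] at h
    simp [h.1, h.2] at hn
  have hts := hw t s (by rw [add_comm, hst])
  simp_rw [add_comm ⌊t * _⌋₊] at hts
  refine mem_closure_of_tendsto (((hw s t hst).smul_const a).add (hts.smul_const b)) ?_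
  filter_upwards [hpos] with n hn
  exact natCast_smul_add_mem_uniformAverages ha hb hn

lemma convexHull_subset_closure_uniformAverages [TopologicalSpace E] [ContinuousAdd E]
    [ContinuousSMul ℝ≥0 E] (S : Set E) : convexHull ℝ≥0 S ⊆ closure (uniformAverages S) :=
  convexHull_min ((subset_uniformAverages S).trans subset_closure)
    (convex_closure_uniformAverages S)

lemma uniformAverages_subset_convexHull (S : Set E) : uniformAverages S ⊆ convexHull ℝ≥0 S := by
  rintro _ ⟨k, hk, v, hv, rfl⟩
  induction k, hk using Nat.le_induction with
  | base => simpa using subset_convexHull ℝ≥0 S (hv 0)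
  | succ k hk ih =>
    have hk' : (k : ℝ≥0) ≠ 0 := by positivity
    have := convex_convexHull ℝ≥0 S (ih (fun j => v j.castSucc) fun j => hv _)
      (subset_convexHull ℝ≥0 S (hv (Fin.last k))) (a := (k : ℝ≥0) / (k + 1)) (b := 1 / (k + 1))
      (by positivity) (by positivity) (by field_simp)
    convert this using 1
    rw [Fin.sum_univ_castSucc, smul_add, smul_smul]
    push_cast
    congr 2 <;> field_simp

end UniformAverages

/-! ### Matchings with few defects -/

/-- A version of Hall's marriage theorem with defect `D`: there is a permutation which respects
the relation `r` except at no more than `D` indices. -/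
lemma exists_perm_card_filter_not_le {ι : Type*} [Fintype ι] (r : ι → ι → Prop)
    [DecidableRel r] (D : ℕ)
    (h : ∀ S : Finset ι, S.card ≤ (Finset.univ.filter fun b => ∃ a ∈ S, r a b).card + D) :
    ∃ σ : Equiv.Perm ι, (Finset.univ.filter fun i => ¬ r i (σ i)).card ≤ D := by
  classical
  let t : ι → Finset (ι ⊕ Fin D) := fun a => (Finset.univ.filter (r a)).disjSum Finset.univ
  have hall : ∀ S : Finset ι, S.card ≤ (S.biUnion t).card := by
    intro S
    rcases S.eq_empty_or_nonempty with rfl | hS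
    · simp
    refine (h S).trans (le_of_eq ?_)
    have : S.biUnion t
        = (Finset.univ.filter fun b => ∃ a ∈ S, r a b).disjSum (Finset.univ : Finset (Fin D)) := by
      ext (b | d)
      · simp [t]
      · simpa [t] using (show ∃ a, a ∈ S from hS)
    rw [this, Finset.card_disjSum, Finset.card_univ, Fintype.card_fin]
  obtain ⟨f, hf, hft⟩ := (Finset.all_card_le_biUnion_card_iff_exists_injective t).1 hall
  let g : ι → ι := fun i => (f i).elim id fun _ => i
  have hg : Set.InjOn g {i | (f i).isLeft} := by
    intro i hi j hj hij
    obtain ⟨a, ha⟩ := Sum.isLeft_iff.1 hi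
    obtain ⟨b, hb⟩ := Sum.isLeft_iff.1 hj
    apply hf
    simp only [g, ha, hb, Sum.elim_inl, id] at hij
    rw [ha, hb, hij]
  obtain ⟨e, he⟩ := Set.MapsTo.exists_equiv_extend_of_card_eq (t := (Finset.univ : Finset ι))
    (Finset.card_univ).symm (fun _ _ => by simp) hg
  refine ⟨e.trans (Equiv.subtypeUnivEquiv (by simp)), ?_⟩
  have hbad : ∀ i ∈ Finset.univ.filter
      (fun i => ¬ r i ((e.trans (Equiv.subtypeUnivEquiv (by simp))) i)),
      f i ∈ (Finset.univ : Finset (Fin D)).map ⟨Sum.inr, Sum.inr_injective⟩ := by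
    intro i hi
    rcases hfi : f i with a | d
    · exfalso
      have h1 := he i (by simp [hfi])
      have h2 := hft i
      simp only [hfi, t, Finset.inl_mem_disjSum, Finset.mem_filter, Finset.mem_univ,
        true_and] at h2
      simp only [g, hfi, Sum.elim_inl, id] at h1
      refine (Finset.mem_filter.1 hi).2 ?_
      change r i (e i : ι)
      rwa [h1]
    · simp
  calc _ ≤ ((Finset.univ : Finset (Fin D)).map
        ⟨(Sum.inr : Fin D → ι ⊕ Fin D), Sum.inr_injective⟩).card :=
        Finset.card_le_card_of_injOn f hbad hf.injOn
    _ = D := by simp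

/-! ### Uniform measures on finite families -/

section UniformMeasure

variable {X : Type*} [MeasurableSpace X]

/-- The average of the Dirac masses at the points of a finite family. -/
noncomputable def familyMeasure {ι : Type*} [Fintype ι] (z : ι → X) : Measure X :=
  (Fintype.card ι : ℝ≥0∞)⁻¹ • ∑ i, Measure.dirac (z i)

lemma familyMeasure_comp_equiv {ι κ : Type*} [Fintype ι] [Fintype κ] (e : κ ≃ ι) (z : ι → X) :
    familyMeasure (fun i => z (e i)) = familyMeasure z := by
  rw [familyMeasure, familyMeasure, Fintype.card_congr e,
    Equiv.sum_comp e fun i => Measure.dirac (z i)]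

lemma familyMeasure_prod {ι κ : Type*} [Fintype ι] [Fintype κ] (z : ι → κ → X) :
    familyMeasure (fun p : ι × κ => z p.1 p.2)
      = (Fintype.card ι : ℝ≥0∞)⁻¹ • ∑ i, familyMeasure (z i) := by
  simp only [familyMeasure]
  rw [← Finset.smul_sum, smul_smul, Fintype.sum_prod_type, Fintype.card_prod, Nat.cast_mul,
    ENNReal.mul_inv (by simp) (by simp)]

lemma familyMeasure_apply {ι : Type*} [Fintype ι] (z : ι → X) {s : Set X} (hs : MeasurableSet s)
    [DecidablePred fun i => z i ∈ s] :
    familyMeasure z s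
      = (Finset.univ.filter fun i => z i ∈ s).card / (Fintype.card ι : ℝ≥0∞) := by
  simp [familyMeasure, Measure.finsetSum_apply, Measure.dirac_apply' _ hs, Set.indicator_apply,
    ENNReal.div_eq_inv_mul]

lemma integral_familyMeasure [MeasurableSingletonClass X] {ι : Type*} [Fintype ι] (z : ι → X)
    (f : X → ℝ) : ∫ x, f x ∂familyMeasure z = (∑ i, f (z i)) / Fintype.card ι := by
  rw [familyMeasure, integral_smul_measure,
    integral_finsetSum_measure fun i _ => integrable_dirac (by simp)]
  simp [div_eq_inv_mul]

/-- The average of a nonempty finite family of probability measures. -/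
noncomputable def averageMeasure {ι : Type*} [Fintype ι] [Nonempty ι]
    (ν : ι → ProbabilityMeasure X) : ProbabilityMeasure X :=
  ⟨(Fintype.card ι : ℝ≥0∞)⁻¹ • ∑ i, (ν i : Measure X), ⟨by
    simp [Measure.finsetSum_apply, ENNReal.inv_mul_cancel]⟩⟩

lemma toFiniteMeasure_averageMeasure {ι : Type*} [Fintype ι] [Nonempty ι]
    (ν : ι → ProbabilityMeasure X) :
    (averageMeasure ν).toFiniteMeasure
      = (Fintype.card ι : ℝ≥0)⁻¹ • ∑ i, (ν i).toFiniteMeasure := by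
  apply Subtype.ext
  change (averageMeasure ν : Measure X) = ((_ : FiniteMeasure X) : Measure X)
  rw [FiniteMeasure.toMeasure_smul, FiniteMeasure.toMeasure_sum]
  simp only [averageMeasure, ProbabilityMeasure.coe_mk,
    ProbabilityMeasure.toMeasure_comp_toFiniteMeasure_eq_toMeasure]
  ext s _
  simp [ENNReal.smul_def, ENNReal.coe_inv]

lemma tendsto_averageMeasure [TopologicalSpace X] [OpensMeasurableSpace X] {ι α : Type*}
    [Fintype ι] [Nonempty ι] {l : Filter α} {ν : α → ι → ProbabilityMeasure X}
    {ν' : ι → ProbabilityMeasure X} (h : ∀ i, Tendsto (fun a => ν a i) l (𝓝 (ν' i))) :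
    Tendsto (fun a => averageMeasure (ν a)) l (𝓝 (averageMeasure ν')) := by
  rw [ProbabilityMeasure.tendsto_nhds_iff_toFiniteMeasure_tendsto_nhds]
  simp only [Function.comp_def, toFiniteMeasure_averageMeasure]
  refine (tendsto_finsetSum _ fun i _ => ?_).const_smul _
  exact (ProbabilityMeasure.tendsto_nhds_iff_toFiniteMeasure_tendsto_nhds _).1 (h i)

lemma coe_avgDirac (x : ℕ → X) {n : ℕ} (hn : 0 < n) :
    (avgDirac x n : Measure X) = familyMeasure fun i : Fin n => x i := by
  have : max n 1 = n := max_eq_left hn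
  simp only [avgDirac, familyMeasure, ProbabilityMeasure.coe_mk, Fintype.card_fin, this,
    Finset.sum_range]

/-- Averaging over several periods of a periodic orbit is the same as averaging over one. -/
lemma avgDirac_mul_of_periodic {T : X → X} {x : X} {p : ℕ} (hp : 0 < p) (hx : T^[p] x = x)
    {m : ℕ} (hm : 0 < m) :
    avgDirac (fun i => T^[i] x) (m * p) = periodicOrbitMeasure T x p := by
  have : NeZero m := ⟨hm.ne'⟩
  apply Subtype.ext
  refine (coe_avgDirac _ (Nat.mul_pos hm hp)).trans (Eq.trans ?_ (coe_avgDirac _ hp).symm)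
  rw [← familyMeasure_comp_equiv finProdFinEquiv]
  have h : ∀ q : Fin m × Fin p, T^[(finProdFinEquiv q : ℕ)] x = T^[(q.2 : ℕ)] x := by
    intro q
    rw [finProdFinEquiv_apply_val, Function.iterate_add_apply,
      (Function.IsPeriodicPt.mul_const (show Function.IsPeriodicPt T p x from hx) _).eq]
  simp only [h]
  rw [familyMeasure_prod fun (_ : Fin m) (i : Fin p) => T^[(i : ℕ)] x, Finset.sum_const,
    Finset.card_univ, ← Nat.cast_smul_eq_nsmul ℝ≥0∞, smul_smul, ENNReal.inv_mul_cancel, one_smul]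
    <;> simp [hm.ne']

/-- The average of the empirical measures of several orbit segments is the uniform measure on
their concatenation. -/
lemma coe_averageMeasure_avgDirac (T : X → X) {k n : ℕ} [NeZero k] (hn : 0 < n) (y : Fin k → X) :
    (averageMeasure (fun j => avgDirac (fun i => T^[i] (y j)) n) : Measure X)
      = familyMeasure fun i : Fin (k * n) =>
        T^[(i : ℕ) % n] (y ⟨(i : ℕ) / n, (Nat.div_lt_iff_lt_mul hn).2 i.isLt⟩) := by
  rw [← familyMeasure_comp_equiv finProdFinEquiv]
  have hdiv : ∀ q : Fin k × Fin n, ((finProdFinEquiv q : Fin (k * n)) : ℕ) / n = q.1 := by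
    intro q
    rw [finProdFinEquiv_apply_val, Nat.add_mul_div_left _ _ hn, Nat.div_eq_of_lt q.2.isLt, zero_add]
  have hmod : ∀ q : Fin k × Fin n, ((finProdFinEquiv q : Fin (k * n)) : ℕ) % n = q.2 := by
    intro q
    rw [finProdFinEquiv_apply_val, Nat.add_mul_mod_self_left, Nat.mod_eq_of_lt q.2.isLt]
  simp only [hdiv, hmod, Fin.eta]
  rw [familyMeasure_prod fun (j : Fin k) (i : Fin n) => T^[(i : ℕ)] (y j)]
  simp only [averageMeasure, ProbabilityMeasure.coe_mk, coe_avgDirac _ hn]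

end UniformMeasure

section Matching

variable {X : Type*} [MetricSpace X] [MeasurableSpace X] [BorelSpace X]

/-- Finite families of the same size whose uniform measures are close for the Lévy–Prokhorov
distance can be matched with small average displacement. -/
lemma exists_perm_sum_dist_le {m : ℕ} (hm : 0 < m) (z w : Fin m → X) {C δ : ℝ} (hC : 0 ≤ C)
    (hd : ∀ a b : X, dist a b ≤ C) (hδ : 0 < δ)
    (h : levyProkhorovEDist (familyMeasure z) (familyMeasure w) < ENNReal.ofReal δ) :
    ∃ σ : Equiv.Perm (Fin m), ∑ i, dist (z i) (w (σ i)) ≤ m * δ + (m * δ + 1) * C := by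
  classical
  obtain ⟨σ, hσ⟩ := exists_perm_card_filter_not_le (fun a b => dist (w b) (z a) < δ) ⌈m * δ⌉₊ <| by
    intro S
    have hS := left_measure_le_of_levyProkhorovEDist_lt h
      (B := z '' (S : Set (Fin m))) (S.finite_toSet.image z).measurableSet
    rw [familyMeasure_apply _ (S.finite_toSet.image z).measurableSet,
      familyMeasure_apply _ Metric.isOpen_thickening.measurableSet,
      ENNReal.toReal_ofReal hδ.le, Fintype.card_fin] at hS
    have hm0 : (m : ℝ≥0∞) ≠ 0 := by simpa using hm.ne'
    have hmul : ENNReal.ofReal δ = ENNReal.ofReal (m * δ) / m := by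
      rw [ENNReal.ofReal_mul (by positivity), ENNReal.ofReal_natCast, mul_comm,
        ENNReal.mul_div_cancel_right hm0 (by simp)]
    rw [hmul, ← ENNReal.add_div, ENNReal.div_le_iff hm0 (by simp),
      ENNReal.div_mul_cancel hm0 (by simp)] at hS
    have h1 : S.card ≤ (Finset.univ.filter fun i => z i ∈ z '' (S : Set (Fin m))).card :=
      Finset.card_le_card fun i hi => by simpa using ⟨i, hi, rfl⟩
    have h2 : (Finset.univ.filter fun b => w b ∈ Metric.thickening δ (z '' (S : Set (Fin m))))
        = Finset.univ.filter fun b => ∃ a ∈ S, dist (w b) (z a) < δ := by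
      ext b
      simp [Metric.mem_thickening_iff]
    rw [h2] at hS
    have h3 : ENNReal.ofReal (m * δ) ≤ (⌈m * δ⌉₊ : ℝ≥0∞) := by
      rw [← ENNReal.ofReal_natCast]
      exact ENNReal.ofReal_le_ofReal (Nat.le_ceil _)
    have h4 := ((Nat.cast_le (α := ℝ≥0∞)).2 h1).trans (hS.trans (add_le_add_right h3 _))
    norm_cast at h4
    convert h4
  refine ⟨σ, ?_⟩
  have hbound : ∀ i, dist (z i) (w (σ i)) ≤ δ + if ¬ dist (w (σ i)) (z i) < δ then C else 0 := by
    intro i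
    split_ifs with hi
    · rw [dist_comm]
      linarith
    · linarith [hd (z i) (w (σ i))]
  have hceil : (⌈m * δ⌉₊ : ℝ) ≤ m * δ + 1 := (Nat.ceil_lt_add_one (by positivity)).le
  calc ∑ i, dist (z i) (w (σ i))
      ≤ ∑ i, (δ + if ¬ dist (w (σ i)) (z i) < δ then C else 0) :=
        Finset.sum_le_sum fun i _ => hbound i
    _ = m * δ + (Finset.univ.filter fun i => ¬ dist (w (σ i)) (z i) < δ).card * C := by
        rw [Finset.sum_add_distrib, ← Finset.sum_filter]
        simp
    _ ≤ m * δ + (m * δ + 1) * C := by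
        gcongr
        exact (Nat.cast_le.2 hσ).trans hceil

/-- A matching bounds the difference of the integrals of a Lipschitz function. -/
lemma abs_integral_familyMeasure_sub_le {m : ℕ} (z w : Fin m → X)
    (σ : Equiv.Perm (Fin m)) {f : X → ℝ} {L : ℝ≥0} (hf : LipschitzWith L f) :
    |∫ x, f x ∂familyMeasure z - ∫ x, f x ∂familyMeasure w|
      ≤ L * ((∑ i, dist (z i) (w (σ i))) / m) := by
  rw [integral_familyMeasure, integral_familyMeasure, ← Equiv.sum_comp σ fun i => f (w i),
    ← sub_div, ← Finset.sum_sub_distrib, abs_div, Fintype.card_fin, Nat.abs_cast, ← mul_div_assoc,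
    Finset.mul_sum]
  gcongr
  refine (Finset.abs_sum_le_sum_abs _ _).trans (Finset.sum_le_sum fun i _ => ?_)
  rw [← Real.dist_eq]
  exact hf.dist_le_mul _ _

end Matching

/-! ### Approximation by periodic orbit measures -/

section PeriodicApproximation

variable {X : Type*} [MetricSpace X] [MeasurableSpace X] [BorelSpace X]

/-- If probability measures `α m` and `β m` are uniform measures on families with asymptotically
vanishing matching cost, then they have the same weak limits. -/
lemma tendsto_of_exists_perm {α β : ℕ → ProbabilityMeasure X} {μ : ProbabilityMeasure X}
    (hα : Tendsto α atTop (𝓝 μ))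
    (h : ∀ m : ℕ, ∃ (s : ℕ) (z w : Fin s → X) (σ : Equiv.Perm (Fin s)),
      (α m : Measure X) = familyMeasure z ∧ (β m : Measure X) = familyMeasure w ∧
        (∑ i, dist (z i) (w (σ i))) / s ≤ 1 / ((m : ℝ) + 1)) :
    Tendsto β atTop (𝓝 μ) := by
  rw [tendsto_iff_forall_lipschitz_integral_tendsto] at hα ⊢
  rintro f hf ⟨L, hL⟩
  refine (hα f hf ⟨L, hL⟩).congr_dist ?_
  have hlim : Tendsto (fun m : ℕ => L * (1 / ((m : ℝ) + 1))) atTop (𝓝 0) := by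
    simpa using tendsto_one_div_add_atTop_nhds_zero_nat.const_mul (L : ℝ)
  refine squeeze_zero (fun _ => dist_nonneg) (fun m => ?_) hlim
  obtain ⟨s, z, w, σ, hz, hw, hσ⟩ := h m
  rw [hz, hw, Real.dist_eq]
  exact (abs_integral_familyMeasure_sub_le z w σ hL).trans (by gcongr)

lemma averageMeasure_mem_closure_perMeasures {T : X → X} {A : Set X} {k : ℕ} [NeZero k]
    {y : Fin k → X} {ν : Fin k → ProbabilityMeasure X} (hν : ∀ j, genericFor T (y j) (ν j))
    (h : ∀ ε > (0 : ℝ), ∀ N : ℕ, ∃ x ∈ A, ∃ n : ℕ, ∃ hn : 0 < n, N ≤ n ∧ T^[k * n] x = x ∧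
      (⨅ σ : Equiv.Perm (Fin (k * n)),
        (∑ i : Fin (k * n),
          dist (T^[(i : ℕ) % n] (y ⟨(i : ℕ) / n, (Nat.div_lt_iff_lt_mul hn).2 i.isLt⟩))
            (T^[((σ i : Fin (k * n)) : ℕ)] x)) / (k * n)) < ε) :
    averageMeasure ν ∈ closure (perMeasures T A) := by
  choose x hxA n hn hNn hx hlt using fun m : ℕ => h (1 / ((m : ℝ) + 1)) (by positivity) m
  have hkn m : 0 < k * n m := Nat.mul_pos (NeZero.pos k) (hn m)
  have hα := tendsto_averageMeasure fun j =>
    (hν j).comp (tendsto_atTop_mono hNn tendsto_id)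
  refine mem_closure_of_tendsto (tendsto_of_exists_perm
    (β := fun m => periodicOrbitMeasure T (x m) (k * n m)) hα fun m => ?_)
    (Eventually.of_forall fun m => ⟨x m, hxA m, k * n m, hkn m, hx m, rfl⟩)
  obtain ⟨σ, hσ⟩ := exists_lt_of_ciInf_lt (hlt m)
  refine ⟨k * n m, _, _, σ, coe_averageMeasure_avgDirac T (hn m) y, coe_avgDirac _ (hkn m), ?_⟩
  push_cast
  exact hσ.le

lemma exists_matching_of_averageMeasure_mem_closure [TopologicalSpace.SeparableSpace X]
    (hd : ∃ C, ∀ a b : X, dist a b ≤ C) {T : X → X} {A : Set X} {k : ℕ} [NeZero k]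
    {y : Fin k → X} {ν : Fin k → ProbabilityMeasure X} (hν : ∀ j, genericFor T (y j) (ν j))
    (h : averageMeasure ν ∈ closure (perMeasures T A)) {ε : ℝ} (hε : 0 < ε) (N : ℕ) :
    ∃ x ∈ A, ∃ n : ℕ, ∃ hn : 0 < n, N ≤ n ∧ T^[k * n] x = x ∧
      (⨅ σ : Equiv.Perm (Fin (k * n)),
        (∑ i : Fin (k * n),
          dist (T^[(i : ℕ) % n] (y ⟨(i : ℕ) / n, (Nat.div_lt_iff_lt_mul hn).2 i.isLt⟩))
            (T^[((σ i : Fin (k * n)) : ℕ)] x)) / (k * n)) < ε := by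
  obtain ⟨C, hC0, hC⟩ : ∃ C : ℝ, 0 ≤ C ∧ ∀ a b : X, dist a b ≤ C := by
    obtain ⟨C, hC⟩ := hd
    exact ⟨max C 0, le_max_right _ _, fun a b => (hC a b).trans (le_max_left _ _)⟩
  obtain ⟨δ, hδ, hδε⟩ : ∃ δ : ℝ, 0 < δ ∧ δ + δ * C = ε / 2 :=
    ⟨ε / 2 / (1 + C), by positivity, by field_simp⟩
  set μ := averageMeasure ν
  have hU : ∀ᶠ α : ProbabilityMeasure X in 𝓝 μ,
      levyProkhorovEDist (α : Measure X) (μ : Measure X) < ENNReal.ofReal (δ / 2) := by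
    have hcont := LevyProkhorov.continuous_ofMeasure_probabilityMeasure.tendsto μ
    exact hcont.eventually (Metric.eball_mem_nhds _ (ENNReal.ofReal_pos.2 (half_pos hδ)))
  obtain ⟨_, ⟨x, hxA, p, hp, hx, rfl⟩, hβU⟩ :=
    ((mem_closure_iff_frequently.1 h).and_eventually hU).exists
  have hα := tendsto_averageMeasure hν
  have hM : Tendsto (fun M : ℕ => p * M) atTop atTop :=
    tendsto_id.const_mul_atTop' hp
  have hsmall : Tendsto (fun n : ℕ => C / n) atTop (𝓝 0) :=
    tendsto_const_div_atTop_nhds_zero_nat C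
  obtain ⟨M, hM0, hNM, hαM, hCM⟩ := ((eventually_gt_atTop 0).and
    ((hM.eventually_ge_atTop N).and (((hα.comp hM).eventually hU).and
      ((hsmall.comp hM).eventually_lt_const (half_pos hε))))).exists
  have hn : 0 < p * M := Nat.mul_pos hp hM0
  have hkn : 0 < k * (p * M) := Nat.mul_pos (NeZero.pos k) hn
  have hperiod : T^[k * (p * M)] x = x := by
    rw [mul_left_comm]
    exact (Function.IsPeriodicPt.mul_const (show Function.IsPeriodicPt T p x from hx) _).eq
  refine ⟨x, hxA, p * M, hn, hNM, hperiod, ?_⟩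
  have hβ : (periodicOrbitMeasure T x p : Measure X)
      = familyMeasure fun i : Fin (k * (p * M)) => T^[(i : ℕ)] x := by
    rw [← avgDirac_mul_of_periodic hp hx (Nat.mul_pos (NeZero.pos k) hM0),
      ← coe_avgDirac (fun i => T^[i] x) hkn]
    congr 2
    ring
  have hclose : levyProkhorovEDist
      (familyMeasure fun i : Fin (k * (p * M)) => T^[(i : ℕ) % (p * M)]
        (y ⟨(i : ℕ) / (p * M), (Nat.div_lt_iff_lt_mul hn).2 i.isLt⟩))
      (familyMeasure fun i : Fin (k * (p * M)) => T^[(i : ℕ)] x) < ENNReal.ofReal δ := by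
    rw [← coe_averageMeasure_avgDirac T hn y, ← hβ]
    refine (levyProkhorovEDist_triangle _ (μ : Measure X) _).trans_lt ?_
    rw [levyProkhorovEDist_comm (μ : Measure X), ← add_halves δ,
      ENNReal.ofReal_add (by positivity) (by positivity)]
    exact ENNReal.add_lt_add hαM hβU
  obtain ⟨σ, hσ⟩ := exists_perm_sum_dist_le hkn _ _ hC0 hC hδ hclose
  refine (ciInf_le (Set.finite_range _).bddBelow σ).trans_lt ?_
  have hpos : (0 : ℝ) < (k * (p * M) : ℕ) := by positivity
  have hle : C / (k * (p * M) : ℕ) ≤ C / (p * M : ℕ) :=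
    div_le_div_of_nonneg_left hC0 (by positivity)
      (Nat.cast_le.2 (Nat.le_mul_of_pos_left _ (NeZero.pos k)))
  rw [← Nat.cast_mul k]
  calc _ ≤ ((k * (p * M) : ℕ) * δ + ((k * (p * M) : ℕ) * δ + 1) * C) / (k * (p * M) : ℕ) := by
        gcongr
    _ = δ + δ * C + C / (k * (p * M) : ℕ) := by
        field_simp
        ring
    _ < ε := by
        simp only [Function.comp_apply] at hCM
        linarith

end PeriodicApproximation

theorem stmt9 {X : Type*} [MetricSpace X] [TopologicalSpace.SeparableSpace X]
    [CompleteSpace X] [MeasurableSpace X] [BorelSpace X]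
    (hd : ∃ C, ∀ a b : X, dist a b ≤ C)
    (T : X → X) (hT : Continuous T) (A B : Set X)
    (hA : ∀ x ∈ A, ∃ p, 0 < p ∧ T^[p] x = x)
    (hB : ∀ y ∈ B, ∃ μ : ProbabilityMeasure X, genericFor T y μ) :
    (closure (convexHull ℝ≥0 (ProbabilityMeasure.toFiniteMeasure ''
          {ν : ProbabilityMeasure X | ∃ y ∈ B, genericFor T y ν}))
        ⊆ closure (ProbabilityMeasure.toFiniteMeasure '' perMeasures T A)) ↔
      (∀ ε > (0 : ℝ), ∀ k : ℕ, 1 ≤ k → ∀ y : Fin k → X, (∀ j, y j ∈ B) → ∀ N : ℕ,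
        ∃ x ∈ A, ∃ n : ℕ, ∃ hn : 0 < n, N ≤ n ∧ T^[k * n] x = x ∧
          (⨅ σ : Equiv.Perm (Fin (k * n)),
            (∑ i : Fin (k * n),
              dist (T^[(i : ℕ) % n] (y ⟨(i : ℕ) / n, (Nat.div_lt_iff_lt_mul hn).2 i.isLt⟩))
                (T^[((σ i : Fin (k * n)) : ℕ)] x)) / (k * n)) < ε) := by
  have hinj := ProbabilityMeasure.toFiniteMeasure_isEmbedding X
  set S := {ν : ProbabilityMeasure X | ∃ y ∈ B, genericFor T y ν}
  constructor
  · intro h ε hε k hk y hy N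
    have : NeZero k := ⟨Nat.one_le_iff_ne_zero.1 hk⟩
    choose ν hν using fun j => hB (y j) (hy j)
    refine exists_matching_of_averageMeasure_mem_closure hd hν ?_ hε N
    rw [hinj.isInducing.closure_eq_preimage_closure_image, Set.mem_preimage]
    refine h (subset_closure (uniformAverages_subset_convexHull _ ?_))
    rw [toFiniteMeasure_averageMeasure]
    exact average_mem_uniformAverages fun j => ⟨ν j, ⟨y j, hy j, hν j⟩, rfl⟩
  · intro h
    refine closure_minimal ((convexHull_subset_closure_uniformAverages _).trans
      (closure_minimal ?_ isClosed_closure)) isClosed_closure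
    rintro _ ⟨k, hk, v, hv, rfl⟩
    have : NeZero k := ⟨hk.ne'⟩
    choose ν hν hνv using hv
    choose y hy hgen using hν
    have hmem := averageMeasure_mem_closure_perMeasures hgen
      fun ε hε N => h ε hε k hk y hy N
    rw [hinj.isInducing.closure_eq_preimage_closure_image, Set.mem_preimage,
      toFiniteMeasure_averageMeasure, Fintype.card_fin] at hmem
    simpa only [hνv] using hmem
end
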